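/- arXiv:2203.00646 — 2 statements merged into one kernel-verified Lean document; each statement's English description precedes it below -/
import Mathlib

section
/- Let $p$ be a prime, let $n\ge 3$, let $1\le k\le n-2$, and let $\alpha$ be the composition of length $n-1$ with first part $3$, with $2$ in the $(k+1)$-th position, and all other parts $1$. Then $g_\alpha(p) = (n-1)p^{2n-k-5} + (n-k-1)(n-2)p^{n-3}(p-1) - (n-k-1)p^{n-3} + \left((n-k-2)+\binom{n-k-2}{2}\right)p^{n-3}(p-2)(p-3)$. -/
/-- `A` is an irreducible subring matrix for the prime `p` with diagonal given by the
composition `α = (e₁, …, e_m)` (so `A` is `(m+1) × (m+1)`): `A` is upper triangular with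
diagonal `(p^{e₁}, …, p^{e_m}, 1)`, last column `(1, …, 1)ᵀ`, the above-diagonal entries
among the first `m` columns are divisible by `p` and lie in `[0, p^{eᵢ})`, and the
componentwise product of any two columns lies in the `ℤ`-span of the columns. -/
def IsIrrSubringMatrix (p : ℕ) {m : ℕ} (α : Fin m → ℕ)
    (A : Matrix (Fin (m + 1)) (Fin (m + 1)) ℤ) : Prop :=
  (∀ i j : Fin (m + 1), (j : ℕ) < (i : ℕ) → A i j = 0) ∧
  (∀ i : Fin m, A i.castSucc i.castSucc = (p : ℤ) ^ α i) ∧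
  (∀ i : Fin (m + 1), A i (Fin.last m) = 1) ∧
  (∀ i j : Fin m, (i : ℕ) < (j : ℕ) →
    (p : ℤ) ∣ A i.castSucc j.castSucc ∧ 0 ≤ A i.castSucc j.castSucc ∧
      A i.castSucc j.castSucc < (p : ℤ) ^ α i) ∧
  (∀ i j : Fin (m + 1), ∃ x : Fin (m + 1) → ℤ, A.mulVec x = fun r => A r i * A r j)

/-- `gMat p α` is the number of irreducible subring matrices with diagonal `α`. -/
noncomputable def gMat (p : ℕ) {m : ℕ} (α : Fin m → ℕ) : ℕ :=
  Nat.card {A : Matrix (Fin (m + 1)) (Fin (m + 1)) ℤ // IsIrrSubringMatrix p α A}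

/-- The number of elements satisfying `P` splits according to a second predicate `Q`. -/
theorem natCard_subtype_split {X : Type*} [Finite X] (P Q : X → Prop) :
    Nat.card {x // P x} = Nat.card {x // P x ∧ Q x} + Nat.card {x // P x ∧ ¬ Q x} := by
  classical
  have := Fintype.ofFinite X
  simp only [Nat.card_eq_fintype_card, Fintype.card_subtype]
  rw [← Finset.card_filter_add_card_filter_not (s := Finset.univ.filter P) Q,
    Finset.filter_filter, Finset.filter_filter]

/-- An injective parametrization of the elements satisfying `P` counts them. -/
theorem natCard_subtype_of_param {T X : Type*} {P : X → Prop} (f : T → X)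
    (hf : Function.Injective f) (hP : ∀ x, P x ↔ ∃ t, f t = x) :
    Nat.card {x // P x} = Nat.card T := by
  have : {x | P x} = Set.range f := Set.ext hP
  rw [← Nat.card_range_of_injective hf, ← this]
  rfl

section OrthogonalIdempotents

variable {F : Type*} [Field F] {ι : Type*}

/-- A family of pairwise orthogonal idempotents. -/
def IsOrthIdem (x : ι → F) : Prop :=
  (∀ i, x i * x i = x i) ∧ ∀ i j, i ≠ j → x i * x j = 0

theorem isOrthIdem_zero : IsOrthIdem (0 : ι → F) := by simp [IsOrthIdem]

theorem isOrthIdem_single [DecidableEq ι] (i : ι) : IsOrthIdem (Pi.single i 1 : ι → F) := by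
  constructor
  · intro j
    by_cases h : j = i <;> simp [h]
  · intro j l hjl
    by_cases h : j = i
    · subst h
      simp [Ne.symm hjl]
    · simp [Pi.single_apply, h]

theorem IsOrthIdem.eq_single [DecidableEq ι] {x : ι → F} (hx : IsOrthIdem x) {i : ι}
    (hi : x i ≠ 0) : x = Pi.single i 1 := by
  funext j
  by_cases h : j = i
  · subst h
    simpa using mul_right_cancel₀ hi ((hx.1 j).trans (one_mul _).symm)
  · simpa [Pi.single_apply, h, hi] using hx.2 j i h

theorem natCard_isOrthIdem [Fintype ι] :
    Nat.card {x : ι → F // IsOrthIdem x} = Fintype.card ι + 1 := by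
  classical
  rw [natCard_subtype_of_param
    (fun o : Option ι => o.elim (0 : ι → F) fun i => Pi.single i 1)]
  · simp
  · rintro (_ | i) (_ | j) h
    · rfl
    · simpa using congrFun h j
    · simpa using congrFun h i
    · by_contra hij
      have : i ≠ j := fun e => hij (by rw [e])
      simpa [Pi.single_apply, this] using congrFun h i
  · intro x
    constructor
    · intro hx
      by_cases h : ∃ i, x i ≠ 0
      · obtain ⟨i, hi⟩ := h
        exact ⟨some i, (hx.eq_single hi).symm⟩
      · push Not at h
        exact ⟨none, (funext h).symm⟩
    · rintro ⟨_ | i, rfl⟩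
      · exact isOrthIdem_zero
      · exact isOrthIdem_single i

end OrthogonalIdempotents

section Conic

variable {F : Type*} [Field F]

/-- The point `v` lies on the conic `x² - x = z(y² - y)`. -/
def OnConic (z : F) (v : F × F) : Prop :=
  v.1 * v.1 - v.1 = z * (v.2 * v.2 - v.2)

/-- The points `v` and `w` are orthogonal for the form `xx' - zyy'`. -/
def IsOrth (z : F) (v w : F × F) : Prop :=
  v.1 * w.1 = z * (v.2 * w.2)

theorem IsOrth.symm {z : F} {v w : F × F} (h : IsOrth z v w) : IsOrth z w v := by
  unfold IsOrth at *
  linear_combination h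

theorem OnConic.isOrth_one_sub {z : F} {v : F × F} (h : OnConic z v) : IsOrth z v (1 - v) := by
  simp only [OnConic, IsOrth, Prod.fst_sub, Prod.snd_sub, Prod.fst_one, Prod.snd_one] at *
  linear_combination -h

theorem OnConic.one_sub {z : F} {v : F × F} (h : OnConic z v) : OnConic z (1 - v) := by
  simp only [OnConic, Prod.fst_sub, Prod.snd_sub, Prod.fst_one, Prod.snd_one] at *
  linear_combination h

theorem onConic_zero (z : F) : OnConic z 0 := by simp [OnConic]

theorem isOrth_zero_left (z : F) (v : F × F) : IsOrth z 0 v := by simp [IsOrth]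

theorem isOrth_zero_right (z : F) (v : F × F) : IsOrth z v 0 := by simp [IsOrth]

/-- A nonzero point of the conic that is not on the isotropic line `x = y` of the case `z = 1`
is anisotropic. -/
theorem OnConic.not_isOrth_self {z : F} {v : F × F} (hz : z ≠ 0) (hv : v ≠ 0)
    (h : OnConic z v) (hd : z = 1 → v.1 ≠ v.2) : ¬ IsOrth z v v := by
  intro ho
  simp only [OnConic, IsOrth] at h ho
  have h1 : v.1 = z * v.2 := by linear_combination ho - h
  have h2 : (z - 1) * (z * (v.2 * v.2)) = 0 := by
    rw [h1] at ho
    linear_combination ho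
  have h3 : v.2 ≠ 0 := by
    intro h3
    exact hv (Prod.ext (by simp [h1, h3]) h3)
  have h4 : z = 1 := by
    simpa [hz, h3, sub_eq_zero] using h2
  exact hd h4 (by rw [h1, h4, one_mul])

theorem eq_one_sub_of_isOrth {z : F} {v w : F × F} (hz : z ≠ 0) (hv : v ≠ 0) (hw : w ≠ 0)
    (hcv : OnConic z v) (hcw : OnConic z w) (hd : z = 1 → v.1 ≠ v.2) (h : IsOrth z v w) :
    w = 1 - v := by
  have hiso := hcv.not_isOrth_self hz hv hd
  obtain ⟨x, y⟩ := v
  obtain ⟨x', y'⟩ := w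
  simp only [OnConic, IsOrth] at *
  have hdet : x * y' - x' * y ≠ 0 := by
    intro hdet
    have hne : x * x - z * (y * y) ≠ 0 := sub_ne_zero.2 hiso
    have h1 : y' * (x * x - z * (y * y)) = 0 := by linear_combination x * hdet + y * h
    have h2 : x' * (x * x - z * (y * y)) = 0 := by
      linear_combination x * h + z * y * hdet
    apply hw
    simp only [mul_eq_zero, hne, or_false] at h1 h2
    simp [h1, h2]
  have h1 : (x' - 1 + x) * (x * y' - x' * y) = 0 := by
    linear_combination (y' * (h + hcv) - y * (h + hcw))
  have h2 : z * (y' - 1 + y) * (x * y' - x' * y) = 0 := by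
    linear_combination (x' * (h + hcv) - x * (h + hcw))
  simp only [mul_eq_zero, hdet, hz, or_false, false_or] at h1 h2
  ext
  · simp only [Prod.fst_sub, Prod.fst_one]
    linear_combination h1
  · simp only [Prod.snd_sub, Prod.snd_one]
    linear_combination h2

/-- The triples `(z, v)` with `v` a point of the conic other than `0`, and off the line `x = y`
if `z = 1`. -/
def ConicPoint (w : F × F × F) : Prop :=
  w.1 ≠ 0 ∧ w.2 ≠ 0 ∧ OnConic w.1 w.2 ∧ (w.1 = 1 → w.2.1 ≠ w.2.2)

theorem natCard_conicPoint_ne_one [Fintype F] {q : ℕ} (hq : Fintype.card F = q) :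
    (Nat.card {w : F × F × F // ConicPoint w ∧ w.2 ≠ 1} : ℤ) = q ^ 2 - 3 * q + 4 := by
  classical
  have hq2 : 2 ≤ q := hq ▸ Fintype.one_lt_card
  have hne : Nat.card {z : F // z ≠ 0} = q - 1 := by
    rw [Nat.card_eq_fintype_card, Fintype.card_subtype_compl]
    simp [hq]
  rw [natCard_subtype_split _ fun w => w.2 = (0, 1),
    natCard_subtype_split (fun w : F × F × F => (ConicPoint w ∧ w.2 ≠ 1) ∧ ¬ w.2 = (0, 1))
      fun w => w.2 = (1, 0),
    natCard_subtype_of_param (fun z : {z : F // z ≠ 0} => ((z : F), (0 : F), (1 : F))),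
    natCard_subtype_of_param (fun z : {z : F // z ≠ 0} => ((z : F), (1 : F), (0 : F))),
    natCard_subtype_of_param
      (fun v : {v : F × F // v ∈ (Finset.univ \ {0, 1} : Finset F).offDiag} =>
        (((v : F × F).1 * (v : F × F).1 - (v : F × F).1)
          / ((v : F × F).2 * (v : F × F).2 - (v : F × F).2), (v : F × F)))]
  · have hc : (Finset.univ \ {0, 1} : Finset F).card = q - 2 := by
      rw [Finset.card_sdiff_of_subset (Finset.subset_univ _), Finset.card_univ, hq,
        Finset.card_pair zero_ne_one]
    rw [hne]
    simp only [Nat.card_eq_fintype_card, Fintype.card_coe, Finset.offDiag_card, hc]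
    obtain ⟨r, rfl⟩ := Nat.exists_eq_add_of_le hq2
    have : (2 + r - 2) = r := by omega
    have h' : 2 + r - 1 = r + 1 := by omega
    rw [this, h']
    push_cast [Nat.cast_sub (Nat.le_mul_self r)]
    ring
  · rintro ⟨v, hv⟩ ⟨w, hw⟩ h
    simpa using (Prod.ext_iff.1 h).2
  · rintro ⟨z, x, y⟩
    constructor
    · rintro ⟨⟨⟨⟨hz, h0, hc, hd⟩, h1⟩, h01⟩, h10⟩
      simp only [OnConic] at *
      have hy : y * y - y ≠ 0 := by
        intro hy
        have hy' : y * (y - 1) = 0 := by linear_combination hy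
        have hx' : x * (x - 1) = 0 := by linear_combination hc + z * hy
        rcases mul_eq_zero.1 hy' with hy' | hy' <;> rcases mul_eq_zero.1 hx' with hx' | hx' <;>
          simp_all [sub_eq_zero]
      have hx : x * x - x ≠ 0 := by
        rw [hc]
        exact mul_ne_zero hz hy
      refine ⟨⟨(x, y), ?_⟩, ?_⟩
      · simp only [Finset.mem_offDiag, Finset.mem_sdiff, Finset.mem_univ, true_and,
          Finset.mem_insert, Finset.mem_singleton]
        refine ⟨?_, ?_, ?_⟩
        · rintro (rfl | rfl) <;> simp at hx
        · rintro (rfl | rfl) <;> simp at hy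
        · rintro rfl
          refine hd (mul_right_cancel₀ hy ?_) rfl
          rw [← hc, one_mul]
      · simp only [Prod.mk.injEq, and_true]
        rw [hc, mul_div_cancel_right₀ _ hy]
    · rintro ⟨⟨⟨x', y'⟩, hv⟩, h⟩
      simp only [Finset.mem_offDiag, Finset.mem_sdiff, Finset.mem_univ, true_and,
        Finset.mem_insert, Finset.mem_singleton, not_or] at hv
      obtain ⟨⟨hx0, hx1⟩, ⟨hy0, hy1⟩, hxy⟩ := hv
      simp only [Prod.mk.injEq] at h
      obtain ⟨rfl, rfl, rfl⟩ := h
      have hx : x' * x' - x' ≠ 0 := by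
        have := mul_ne_zero hx0 (sub_ne_zero.2 hx1)
        contrapose! this
        linear_combination this
      have hy : y' * y' - y' ≠ 0 := by
        have := mul_ne_zero hy0 (sub_ne_zero.2 hy1)
        contrapose! this
        linear_combination this
      refine ⟨⟨⟨⟨div_ne_zero hx hy, ?_, ?_, fun _ => hxy⟩, ?_⟩, ?_⟩, ?_⟩
      · simp [hx0]
      · simp [OnConic, hy]
      · simp [Prod.ext_iff, hx1]
      · simp [hx0]
      · simp [hx1]
  · rintro z w h
    exact Subtype.ext (Prod.ext_iff.1 h).1
  · rintro ⟨z, x, y⟩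
    constructor
    · rintro ⟨⟨⟨⟨hz, -⟩, -⟩, -⟩, h⟩
      exact ⟨⟨z, hz⟩, by simp_all⟩
    · rintro ⟨⟨z', hz⟩, h⟩
      simp only [Prod.mk.injEq] at h
      obtain ⟨rfl, rfl, rfl⟩ := h
      simp [ConicPoint, OnConic, hz, Prod.ext_iff]
  · rintro z w h
    exact Subtype.ext (Prod.ext_iff.1 h).1
  · rintro ⟨z, x, y⟩
    constructor
    · rintro ⟨⟨⟨hz, -⟩, -⟩, h⟩
      exact ⟨⟨z, hz⟩, by simp_all⟩
    · rintro ⟨⟨z', hz⟩, h⟩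
      simp only [Prod.mk.injEq] at h
      obtain ⟨rfl, rfl, rfl⟩ := h
      simp [ConicPoint, OnConic, hz, Prod.ext_iff]

theorem natCard_ne_zero_ne_one [Fintype F] {q : ℕ} (hq : Fintype.card F = q) :
    (Nat.card {z : F // z ≠ 0 ∧ z ≠ 1} : ℤ) = q - 2 := by
  classical
  have hq2 : 2 ≤ q := hq ▸ Fintype.one_lt_card
  have h : (Finset.univ.filter fun z : F => z ≠ 0 ∧ z ≠ 1) = Finset.univ \ {0, 1} := by
    ext z
    simp
  rw [Nat.card_eq_fintype_card, Fintype.card_subtype, h,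
    Finset.card_sdiff_of_subset (Finset.subset_univ _), Finset.card_univ, hq,
    Finset.card_pair zero_ne_one]
  omega

theorem natCard_conicPoint [Fintype F] {q : ℕ} (hq : Fintype.card F = q) :
    (Nat.card {w : F × F × F // ConicPoint w} : ℤ) = q ^ 2 - 2 * q + 2 := by
  rw [natCard_subtype_split _ fun w => w.2 = 1, Nat.cast_add, natCard_conicPoint_ne_one hq,
    natCard_subtype_of_param (fun z : {z : F // z ≠ 0 ∧ z ≠ 1} => ((z : F), (1 : F × F))),
    natCard_ne_zero_ne_one hq]
  · ring
  · rintro z w h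
    exact Subtype.ext (Prod.ext_iff.1 h).1
  · rintro ⟨z, v⟩
    constructor
    · rintro ⟨⟨hz, -, -, hd⟩, rfl : v = 1⟩
      exact ⟨⟨z, hz, fun h => hd h rfl⟩, rfl⟩
    · rintro ⟨⟨z', hz, hz1⟩, h⟩
      simp only [Prod.mk.injEq] at h
      obtain ⟨rfl, rfl⟩ := h
      simp [ConicPoint, OnConic, hz, hz1]

end Conic

section Compat

variable {F : Type*} [Field F] {a s : ℕ}

/-- The system of equations over the residue field that governs irreducible subring matrices
with diagonal `(3, 1, …, 1, 2, 1, …, 1)`, with `a` ones before and `s` ones after the `2`. -/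
def IsCompat (g : F × (Fin a → F) × (Fin s → F × F)) : Prop :=
  IsOrthIdem g.2.1 ∧ (∀ c t, g.2.1 c * (g.2.2 t).1 = 0) ∧ (∀ t, OnConic g.1 (g.2.2 t)) ∧
    ∀ t t', t ≠ t' → IsOrth g.1 (g.2.2 t) (g.2.2 t')

/-- All points of the family lie on the isotropic line `x = y` of the case `z = 1`. -/
def IsDiag (g : F × (Fin a → F) × (Fin s → F × F)) : Prop :=
  g.1 = 1 ∧ ∀ t, (g.2.2 t).1 = (g.2.2 t).2

theorem natCard_isCompat_fst_eq_zero [Fintype F] {q : ℕ} (hq : Fintype.card F = q) :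
    Nat.card {g : F × (Fin a → F) × (Fin s → F × F) // IsCompat g ∧ g.1 = 0} =
      (a + s + 1) * q ^ s := by
  rw [natCard_subtype_of_param
    (fun w : {x : Fin a ⊕ Fin s → F // IsOrthIdem x} × (Fin s → F) =>
      ((0 : F), (fun c => (w.1 : Fin a ⊕ Fin s → F) (Sum.inl c)),
        fun t => ((w.1 : Fin a ⊕ Fin s → F) (Sum.inr t), w.2 t))),
    Nat.card_prod, natCard_isOrthIdem, Nat.card_fun]
  · simp [hq]
  · rintro ⟨⟨x, hx⟩, y⟩ ⟨⟨x', hx'⟩, y'⟩ h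
    simp only [Prod.mk.injEq, true_and] at h
    obtain ⟨h1, h2⟩ := h
    have h3 : x = x' := by
      funext i
      rcases i with c | t
      · exact congrFun h1 c
      · exact (Prod.ext_iff.1 (congrFun h2 t)).1
    have h4 : y = y' := funext fun t => (Prod.ext_iff.1 (congrFun h2 t)).2
    subst h3 h4
    rfl
  · rintro ⟨z, xa, u⟩
    constructor
    · rintro ⟨⟨⟨h1, h2⟩, h3, h4, h5⟩, rfl : z = 0⟩
      refine ⟨⟨⟨Sum.elim xa fun t => (u t).1, ?_, ?_⟩, fun t => (u t).2⟩, rfl⟩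
      · rintro (c | t)
        · exact h1 c
        · have := h4 t
          simp only [OnConic, zero_mul] at this
          exact sub_eq_zero.1 this
      · rintro (c | t) (c' | t') h
        · exact h2 c c' fun e => h (by rw [e])
        · exact h3 c t'
        · exact (mul_comm _ _).trans (h3 c' t)
        · simpa [IsOrth] using h5 t t' fun e => h (by rw [e])
    · rintro ⟨⟨⟨x, h1, h2⟩, y⟩, h⟩
      rw [← h]
      refine ⟨⟨⟨fun c => h1 _, fun c c' hc => h2 _ _ (by simpa using hc)⟩,
        fun c t => h2 _ _ (by simp), fun t => ?_, fun t t' ht => ?_⟩, rfl⟩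
      · simp [OnConic, h1]
      · simpa [IsOrth] using h2 (Sum.inr t) (Sum.inr t') (by simpa using ht)

theorem natCard_isCompat_snd_ne_zero [Fintype F] {q : ℕ} (hq : Fintype.card F = q) :
    Nat.card {g : F × (Fin a → F) × (Fin s → F × F) //
      (IsCompat g ∧ ¬ g.1 = 0) ∧ ¬ g.2.1 = 0} = (q - 1) * (a * (s + 1)) := by
  classical
  rw [natCard_subtype_of_param
    (fun w : {z : F // z ≠ 0} × Fin a × {y : Fin s → F // IsOrthIdem y} =>
      ((w.1 : F), (Pi.single w.2.1 1 : Fin a → F),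
        fun t => ((0 : F), (w.2.2 : Fin s → F) t))),
    Nat.card_prod, Nat.card_prod, natCard_isOrthIdem]
  · rw [Nat.card_eq_fintype_card, Fintype.card_subtype_compl]
    simp [hq]
  · rintro ⟨⟨z, hz⟩, c, ⟨y, hy⟩⟩ ⟨⟨z', hz'⟩, c', ⟨y', hy'⟩⟩ h
    simp only [Prod.mk.injEq] at h
    obtain ⟨rfl, h2, h3⟩ := h
    have h4 : y = y' := funext fun t => (Prod.ext_iff.1 (congrFun h3 t)).2
    have h5 : c = c' := by
      by_contra hc
      simpa [hc] using congrFun h2 c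
    subst h4 h5
    rfl
  · rintro ⟨z, xa, u⟩
    constructor
    · rintro ⟨⟨⟨h1, h3, h4, h5⟩, hz⟩, hx⟩
      dsimp only at *
      obtain ⟨c, hc⟩ := Function.ne_iff.1 hx
      have hu : ∀ t, (u t).1 = 0 := fun t => (mul_eq_zero.1 (h3 c t)).resolve_left hc
      refine ⟨⟨⟨z, hz⟩, c, ⟨fun t => (u t).2, fun t => ?_, fun t t' ht => ?_⟩⟩, ?_⟩
      · have := h4 t
        simpa [OnConic, hu, hz, sub_eq_zero] using this.symm
      · simpa [IsOrth, hu, hz] using h5 t t' ht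
      · rw [h1.eq_single hc]
        simp only [Prod.mk.injEq, true_and]
        exact funext fun t => Prod.ext (hu t).symm rfl
    · rintro ⟨⟨⟨z', hz⟩, c, ⟨y, hy⟩⟩, h⟩
      rw [← h]
      refine ⟨⟨⟨isOrthIdem_single c, by simp, fun t => ?_, fun t t' ht => ?_⟩, hz⟩, ?_⟩
      · simp [OnConic, hy.1]
      · simp [IsOrth, hy.2 t t' ht]
      · intro h0
        simpa using congrFun h0 c

theorem natCard_isCompat_isDiag [Fintype F] {q : ℕ} (hq : Fintype.card F = q) :
    Nat.card {g : F × (Fin a → F) × (Fin s → F × F) //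
      ((IsCompat g ∧ ¬ g.1 = 0) ∧ g.2.1 = 0) ∧ IsDiag g} = q ^ s := by
  rw [natCard_subtype_of_param
    (fun f : Fin s → F => ((1 : F), (0 : Fin a → F), fun t => (f t, f t))), Nat.card_fun]
  · simp [hq]
  · intro f f' h
    simp only [Prod.mk.injEq, true_and] at h
    exact funext fun t => (Prod.ext_iff.1 (congrFun h t)).1
  · rintro ⟨z, xa, u⟩
    constructor
    · rintro ⟨⟨-, rfl : xa = 0⟩, rfl : z = 1, h⟩
      refine ⟨fun t => (u t).1, ?_⟩
      simp only [Prod.mk.injEq, true_and]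
      exact funext fun t => Prod.ext rfl (h t)
    · rintro ⟨f, h⟩
      rw [← h]
      simp [IsCompat, isOrthIdem_zero, IsDiag, OnConic, IsOrth]

theorem natCard_isCompat_eq_zero [Fintype F] {q : ℕ} (hq : Fintype.card F = q) :
    (Nat.card {g : F × (Fin a → F) × (Fin s → F × F) //
      (((IsCompat g ∧ ¬ g.1 = 0) ∧ g.2.1 = 0) ∧ ¬ IsDiag g) ∧ g.2.2 = 0} : ℤ) = q - 2 := by
  rw [natCard_subtype_of_param
    (fun z : {z : F // z ≠ 0 ∧ z ≠ 1} =>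
      ((z : F), (0 : Fin a → F), (0 : Fin s → F × F))), natCard_ne_zero_ne_one hq]
  · intro z w h
    exact Subtype.ext (Prod.ext_iff.1 h).1
  · rintro ⟨z, xa, u⟩
    constructor
    · rintro ⟨⟨⟨⟨-, hz⟩, rfl : xa = 0⟩, hd⟩, rfl : u = 0⟩
      exact ⟨⟨z, hz, fun h => hd ⟨h, by simp⟩⟩, rfl⟩
    · rintro ⟨⟨z', hz, hz1⟩, h⟩
      rw [← h]
      simp [IsCompat, isOrthIdem_zero, IsDiag, OnConic, IsOrth, hz, hz1]

theorem IsCompat.fst_ne_snd {g : F × (Fin a → F) × (Fin s → F × F)} (hg : IsCompat g)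
    (hd : ¬ IsDiag g) {t : Fin s} (ht : g.2.2 t ≠ 0) (hz : g.1 = 1) :
    (g.2.2 t).1 ≠ (g.2.2 t).2 := by
  intro h
  refine hd ⟨hz, fun t' => ?_⟩
  by_cases htt : t' = t
  · rw [htt, h]
  · have h1 := hg.2.2.2 t t' (Ne.symm htt)
    have h2 : (g.2.2 t).2 ≠ 0 := fun h2 => ht (Prod.ext (h.trans h2) h2)
    rw [IsOrth, hz, one_mul, h] at h1
    exact mul_left_cancel₀ h2 h1

theorem natCard_isCompat_single [Fintype F] {q : ℕ} (hq : Fintype.card F = q) :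
    (Nat.card {g : F × (Fin a → F) × (Fin s → F × F) //
      ((((IsCompat g ∧ ¬ g.1 = 0) ∧ g.2.1 = 0) ∧ ¬ IsDiag g) ∧ ¬ g.2.2 = 0) ∧
        ∃ t, ∀ t', t' ≠ t → g.2.2 t' = 0} : ℤ) = s * (q ^ 2 - 2 * q + 2) := by
  classical
  rw [natCard_subtype_of_param
    (fun w : Fin s × {w : F × F × F // ConicPoint w} =>
      ((w.2 : F × F × F).1, (0 : Fin a → F),
        (Pi.single w.1 (w.2 : F × F × F).2 : Fin s → F × F))),
    Nat.card_prod, Nat.cast_mul, natCard_conicPoint hq]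
  · simp
  · rintro ⟨t, ⟨⟨z, v⟩, hv⟩⟩ ⟨t', ⟨⟨z', v'⟩, hv'⟩⟩ h
    simp only [Prod.mk.injEq, true_and] at h
    obtain ⟨rfl, h⟩ := h
    have ht : t = t' := by
      by_contra ht
      exact hv.2.1 (by simpa [ht] using congrFun h t)
    subst ht
    have : v = v' := by simpa using congrFun h t
    subst this
    rfl
  · rintro ⟨z, xa, u⟩
    constructor
    · rintro ⟨⟨⟨⟨⟨hg, hz⟩, rfl : xa = 0⟩, hd⟩, hu⟩, t, ht⟩
      dsimp only at *
      have hut : u = Pi.single t (u t) := by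
        funext t'
        by_cases h : t' = t
        · subst h
          simp
        · simp [h, ht t' h]
      have h0 : u t ≠ 0 := fun h0 => hu (by rw [hut, h0, Pi.single_zero])
      exact ⟨⟨t, ⟨(z, u t), hz, h0, hg.2.2.1 t, fun h => hg.fst_ne_snd hd h0 h⟩⟩, by
        simp only [← hut]⟩
    · rintro ⟨⟨t, ⟨⟨z', v⟩, hz, h0, hc, hd⟩⟩, h⟩
      rw [← h]
      refine ⟨⟨⟨⟨⟨⟨isOrthIdem_zero, by simp, fun t' => ?_, fun t' t'' ht => ?_⟩, hz⟩, rfl⟩,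
        fun h => ?_⟩, fun h => ?_⟩, t, fun t' ht => ?_⟩
      · by_cases h : t' = t
        · subst h
          simpa using hc
        · simpa [h] using onConic_zero z'
      · by_cases h : t' = t
        · subst h
          simpa [ht.symm] using isOrth_zero_right z' _
        · simpa [h] using isOrth_zero_left z' _
      · exact hd h.1 (by simpa using h.2 t)
      · exact h0 (by simpa using congrFun h t)
      · simp [ht]

/-- The family with value `v` at `t`, value `1 - v` at `t'`, and `0` elsewhere. -/
def pairFamily (t t' : Fin s) (v : F × F) (i : Fin s) : F × F :=
  if i = t then v else if i = t' then 1 - v else 0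

theorem pairFamily_injective {t t' r r' : Fin s} {v w : F × F} (ht : t < t') (hr : r < r')
    (hv0 : v ≠ 0) (hv1 : v ≠ 1) (h : pairFamily t t' v = pairFamily r r' w) :
    t = r ∧ t' = r' ∧ v = w := by
  have hv1' : 1 - v ≠ 0 := sub_ne_zero.2 (Ne.symm hv1)
  have h1 := congrFun h t
  have h2 := congrFun h t'
  simp only [pairFamily, if_true, if_neg ht.ne'] at h1 h2
  by_cases e : t = r
  · subst e
    by_cases e' : t' = r'
    · subst e'
      simpa using h1
    · simp [ht.ne', e', hv1'] at h2
  · by_cases e' : t = r'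
    · exfalso
      subst e'
      by_cases e'' : t' = r
      · exact absurd (e'' ▸ hr) (not_lt_of_gt ht)
      · simp [ht.ne', e'', hv1'] at h2
    · simp [e, e', hv0] at h1

theorem natCard_fin_lt (s : ℕ) :
    Nat.card {w : Fin s × Fin s // w.1 < w.2} = s.choose 2 := by
  classical
  have h : 2 * Nat.card {w : Fin s × Fin s // w.1 < w.2} = s * (s - 1) := by
    have h1 := natCard_subtype_split (fun w : Fin s × Fin s => w.1 ≠ w.2) fun w => w.1 < w.2
    have h2 : Nat.card {w : Fin s × Fin s // w.1 ≠ w.2 ∧ w.1 < w.2} =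
        Nat.card {w : Fin s × Fin s // w.1 < w.2} :=
      Nat.card_congr (Equiv.subtypeEquivRight fun w => ⟨fun h => h.2, fun h => ⟨h.ne, h⟩⟩)
    have h3 : Nat.card {w : Fin s × Fin s // w.1 ≠ w.2 ∧ ¬ w.1 < w.2} =
        Nat.card {w : Fin s × Fin s // w.1 < w.2} :=
      Nat.card_congr ((Equiv.prodComm _ _).subtypeEquiv fun w =>
        ⟨fun h => lt_of_le_of_ne (not_lt.1 h.2) h.1.symm, fun h => ⟨h.ne', h.not_gt⟩⟩)
    have h4 : Nat.card {w : Fin s × Fin s // w.1 ≠ w.2} = s * (s - 1) := by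
      rw [Nat.card_eq_fintype_card, Fintype.card_subtype]
      have : (Finset.univ.filter fun w : Fin s × Fin s => w.1 ≠ w.2) =
          (Finset.univ : Finset (Fin s)).offDiag := by
        ext w
        simp
      rw [this, Finset.offDiag_card, Finset.card_univ, Fintype.card_fin, Nat.mul_sub_one]
    omega
  rw [Nat.choose_two_right]
  omega

theorem natCard_isCompat_pair [Fintype F] {q : ℕ} (hq : Fintype.card F = q) :
    (Nat.card {g : F × (Fin a → F) × (Fin s → F × F) //
      ((((IsCompat g ∧ ¬ g.1 = 0) ∧ g.2.1 = 0) ∧ ¬ IsDiag g) ∧ ¬ g.2.2 = 0) ∧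
        ¬ ∃ t, ∀ t', t' ≠ t → g.2.2 t' = 0} : ℤ) =
      s.choose 2 * (q ^ 2 - 3 * q + 4) := by
  classical
  rw [natCard_subtype_of_param
    (fun w : {w : Fin s × Fin s // w.1 < w.2} × {w : F × F × F // ConicPoint w ∧ w.2 ≠ 1} =>
      ((w.2 : F × F × F).1, (0 : Fin a → F),
        pairFamily (w.1 : Fin s × Fin s).1 (w.1 : Fin s × Fin s).2 (w.2 : F × F × F).2)),
    Nat.card_prod, Nat.cast_mul, natCard_conicPoint_ne_one hq, natCard_fin_lt]
  · rintro ⟨⟨⟨t, t'⟩, ht⟩, ⟨⟨z, v⟩, hv, hv1⟩⟩ ⟨⟨⟨r, r'⟩, hr⟩, ⟨⟨z', w⟩, hw, hw1⟩⟩ h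
    simp only [Prod.mk.injEq, true_and] at h
    obtain ⟨rfl, h⟩ := h
    obtain ⟨rfl, rfl, rfl⟩ := pairFamily_injective ht hr hv.2.1 hv1 h
    rfl
  · rintro ⟨z, xa, u⟩
    constructor
    · rintro ⟨⟨⟨⟨⟨hg, hz⟩, rfl : xa = 0⟩, hd⟩, hu⟩, hs⟩
      dsimp only at *
      push Not at hs
      obtain ⟨t, ht⟩ := Function.ne_iff.1 hu
      obtain ⟨t', htt, ht'⟩ := hs t
      have key : ∀ r r', r ≠ r' → u r ≠ 0 → u r' ≠ 0 → u r' = 1 - u r := fun r r' hr h0 h0' =>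
        eq_one_sub_of_isOrth hz h0 h0' (hg.2.2.1 r) (hg.2.2.1 r')
          (fun h => hg.fst_ne_snd hd h0 h) (hg.2.2.2 r r' hr)
      have hrest : ∀ r, r ≠ t → r ≠ t' → u r = 0 := by
        intro r hr hr'
        by_contra h0
        have h1 := key t r (Ne.symm hr) ht h0
        have h2 := key t' r (Ne.symm hr') ht' h0
        have h3 : u t = u t' := sub_right_injective (h1.symm.trans h2)
        refine (hg.2.2.1 t).not_isOrth_self hz ht (fun h => hg.fst_ne_snd hd ht h) ?_
        have := hg.2.2.2 t t' (Ne.symm htt)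
        simp only at this
        rwa [← h3] at this
      have hfam : ∀ r r', r < r' → u r ≠ 0 → u r' ≠ 0 →
          (∀ i, i ≠ r → i ≠ r' → u i = 0) → ∃ w : {w : Fin s × Fin s // w.1 < w.2} ×
            {w : F × F × F // ConicPoint w ∧ w.2 ≠ 1}, ((w.2 : F × F × F).1, (0 : Fin a → F),
        pairFamily (w.1 : Fin s × Fin s).1 (w.1 : Fin s × Fin s).2 (w.2 : F × F × F).2) =
          (z, 0, u) := by
        intro r r' hr h0 h0' hi
        have h1 := key r r' hr.ne h0 h0'
        refine ⟨⟨⟨(r, r'), hr⟩, ⟨(z, u r), ⟨hz, h0, hg.2.2.1 r,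
          fun h => hg.fst_ne_snd hd h0 h⟩, fun h => h0' ?_⟩⟩, ?_⟩
        · rw [h1, show u r = 1 from h, sub_self]
        · simp only [Prod.mk.injEq, true_and]
          funext i
          unfold pairFamily
          split_ifs with e e'
          · rw [e]
          · rw [e', h1]
          · exact (hi i e e').symm
      rcases lt_or_gt_of_ne htt with h | h
      · exact hfam t' t h ht' ht fun i hi hi' => hrest i hi' hi
      · exact hfam t t' h ht ht' hrest
    · rintro ⟨⟨⟨⟨t, t'⟩, ht⟩, ⟨⟨z', v⟩, ⟨hz, h0, hc, hd⟩, hv1⟩⟩, h⟩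
      rw [← h]
      have ht' : t' ≠ t := ht.ne'
      have hv1' : 1 - v ≠ 0 := sub_ne_zero.2 (Ne.symm hv1)
      have e1 : pairFamily t t' v t = v := by simp [pairFamily]
      have e2 : pairFamily t t' v t' = 1 - v := by simp [pairFamily, ht']
      refine ⟨⟨⟨⟨⟨⟨isOrthIdem_zero, by simp, fun r => ?_, fun r r' hr => ?_⟩, hz⟩, rfl⟩,
        fun h => ?_⟩, fun h => ?_⟩, ?_⟩
      · simp only [pairFamily]
        split_ifs
        · exact hc
        · exact hc.one_sub
        · exact onConic_zero _
      · simp only [pairFamily]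
        split_ifs with h1 h2 h3 h4 h5 h6
        · exact absurd (h1.trans h2.symm) hr
        · exact hc.isOrth_one_sub
        · exact isOrth_zero_right _ _
        · exact hc.isOrth_one_sub.symm
        · exact absurd (h4.trans h6.symm) hr
        · exact isOrth_zero_right _ _
        all_goals exact isOrth_zero_left _ _
      · exact hd h.1 (by simpa only [e1] using h.2 t)
      · exact h0 (e1.symm.trans (congrFun h t))
      · rintro ⟨r, hr⟩
        by_cases h : t = r
        · exact hv1' (e2.symm.trans (hr t' (h ▸ ht')))
        · exact h0 (e1.symm.trans (hr t h))

theorem natCard_isCompat [Fintype F] {q : ℕ} (hq : Fintype.card F = q) :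
    (Nat.card {g : F × (Fin a → F) × (Fin s → F × F) // IsCompat g} : ℤ) =
      (a + s + 2) * q ^ s + (s + 1) * (a + s + 1) * (q - 1) - (s + 1)
        + (s + s.choose 2) * (q - 2) * (q - 3) := by
  classical
  have hq1 : 1 ≤ q := hq ▸ Fintype.card_pos
  rw [natCard_subtype_split _ fun g => g.1 = 0, natCard_isCompat_fst_eq_zero hq,
    natCard_subtype_split (fun g : F × (Fin a → F) × (Fin s → F × F) =>
      IsCompat g ∧ ¬ g.1 = 0) fun g => g.2.1 = 0, natCard_isCompat_snd_ne_zero hq,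
    natCard_subtype_split (fun g : F × (Fin a → F) × (Fin s → F × F) =>
      (IsCompat g ∧ ¬ g.1 = 0) ∧ g.2.1 = 0) IsDiag, natCard_isCompat_isDiag hq,
    natCard_subtype_split (fun g : F × (Fin a → F) × (Fin s → F × F) =>
      ((IsCompat g ∧ ¬ g.1 = 0) ∧ g.2.1 = 0) ∧ ¬ IsDiag g) fun g => g.2.2 = 0,
    natCard_subtype_split (fun g : F × (Fin a → F) × (Fin s → F × F) =>
      (((IsCompat g ∧ ¬ g.1 = 0) ∧ g.2.1 = 0) ∧ ¬ IsDiag g) ∧ ¬ g.2.2 = 0)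
      fun g => ∃ t, ∀ t', t' ≠ t → g.2.2 t' = 0]
  push_cast [Nat.cast_sub hq1]
  rw [natCard_isCompat_eq_zero hq, natCard_isCompat_single hq, natCard_isCompat_pair hq]
  have hs : (s : ℤ) * s = 2 * s.choose 2 + s := by
    have h := Nat.choose_two_right s
    have h2 : 2 ∣ s * (s - 1) := (Nat.even_mul_pred_self s).two_dvd
    have h3 : s * s = 2 * s.choose 2 + s := by
      rcases s with _ | s
      · simp
      · simp only [Nat.add_sub_cancel] at h h2
        rw [h, Nat.mul_div_cancel' h2]
        ring
    exact_mod_cast h3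
  linear_combination (1 - (q : ℤ)) * hs

end Compat

section Positions

variable {a s : ℕ} {β : Type*}

/-- The first of the `1 + a + 1 + s` positions. -/
def posZero (a s : ℕ) : Fin (1 + a + 1 + s) :=
  Fin.castAdd s (Fin.castSucc (Fin.castAdd a 0))

/-- The positions between the first one and the distinguished one. -/
def posA (s : ℕ) (c : Fin a) : Fin (1 + a + 1 + s) :=
  Fin.castAdd s (Fin.castSucc (Fin.natAdd 1 c))

/-- The distinguished position. -/
def posK (a s : ℕ) : Fin (1 + a + 1 + s) :=
  Fin.castAdd s (Fin.last (1 + a))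

/-- The positions after the distinguished one. -/
def posB (a : ℕ) (t : Fin s) : Fin (1 + a + 1 + s) :=
  Fin.natAdd (1 + a + 1) t

@[simp] theorem val_posZero : (posZero a s : ℕ) = 0 := rfl

@[simp] theorem val_posA (c : Fin a) : (posA s c : ℕ) = 1 + c := rfl

@[simp] theorem val_posK : (posK a s : ℕ) = 1 + a := rfl

@[simp] theorem val_posB (t : Fin s) : (posB a t : ℕ) = 1 + a + 1 + t := rfl

theorem forall_pos {Q : Fin (1 + a + 1 + s) → Prop} :
    (∀ i, Q i) ↔ Q (posZero a s) ∧ (∀ c, Q (posA s c)) ∧ Q (posK a s) ∧ ∀ t, Q (posB a t) := by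
  refine ⟨fun h => ⟨h _, fun _ => h _, h _, fun _ => h _⟩, fun ⟨h0, ha, hk, hb⟩ i => ?_⟩
  refine Fin.addCases (fun i => ?_) (fun t => hb t) i
  refine Fin.lastCases hk (fun i => ?_) i
  refine Fin.addCases (fun i => ?_) (fun c => ha c) i
  rw [Subsingleton.elim i 0]
  exact h0

theorem forall_pos_succ {Q : Fin (1 + a + 1 + s + 1) → Prop} :
    (∀ i, Q i) ↔ (Q (posZero a s).castSucc ∧ (∀ c, Q (posA s c).castSucc) ∧
      Q (posK a s).castSucc ∧ ∀ t, Q (posB a t).castSucc) ∧ Q (Fin.last _) := by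
  rw [Fin.forall_fin_succ', forall_pos]

theorem sum_pos_succ (f : Fin (1 + a + 1 + s + 1) → ℤ) :
    ∑ i, f i = f (posZero a s).castSucc + ∑ c, f (posA s c).castSucc
      + f (posK a s).castSucc + ∑ t, f (posB a t).castSucc + f (Fin.last _) := by
  rw [Fin.sum_univ_castSucc, Fin.sum_univ_add, Fin.sum_univ_castSucc, Fin.sum_univ_add,
    Fin.sum_univ_one]
  rfl

/-- The vector with the given entries at the four kinds of positions. -/
def blockVec (f0 : β) (fa : Fin a → β) (fk : β) (fb : Fin s → β) : Fin (1 + a + 1 + s) → β :=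
  Fin.append (Fin.snoc (α := fun _ => β) (Fin.append (fun _ => f0) fa) fk) fb

variable (f0 : β) (fa : Fin a → β) (fk : β) (fb : Fin s → β)

@[simp] theorem blockVec_posZero : blockVec f0 fa fk fb (posZero a s) = f0 := by
  simp [blockVec, posZero]

@[simp] theorem blockVec_posA (c : Fin a) : blockVec f0 fa fk fb (posA s c) = fa c := by
  rw [blockVec, posA, Fin.append_left, Fin.snoc_castSucc, Fin.append_right]

@[simp] theorem blockVec_posK : blockVec f0 fa fk fb (posK a s) = fk := by
  simp [blockVec, posK]

@[simp] theorem blockVec_posB (t : Fin s) : blockVec f0 fa fk fb (posB a t) = fb t := by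
  simp [blockVec, posB]

end Positions

section BlockMatrix

variable {a s : ℕ} (p : ℕ) (Xa : Fin a → ℤ) (Xk : ℤ) (Xb Yb : Fin s → ℤ)

/-- The upper-triangular matrix with diagonal `(p³, p, …, p, p², p, …, p, 1)` and last column
`1`, whose other nonzero entries are those of the first row and of the row of `p²`, given by
`p` times `Xa`, `Xk`, `Xb` and by `p` times `Yb`. -/
def blockMatrix : Matrix (Fin (1 + a + 1 + s + 1)) (Fin (1 + a + 1 + s + 1)) ℤ := fun i j =>
  Fin.snoc (α := fun _ => ℤ) (fun j =>
    Fin.snoc (α := fun _ => ℤ)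
      (blockVec (blockVec ((p : ℤ) ^ 3) 0 0 0)
        (fun c => blockVec (p * Xa c) (Pi.single c (p : ℤ)) 0 0)
        (blockVec (p * Xk) 0 ((p : ℤ) ^ 2) 0)
        (fun t => blockVec (p * Xb t) 0 (p * Yb t) (Pi.single t (p : ℤ))) j) 0 i) 1 j

variable {p Xa Xk Xb Yb}

theorem exists_mulVec_blockMatrix_iff (hp : p ≠ 0) {w : Fin (1 + a + 1 + s + 1) → ℤ}
    {ua : Fin a → ℤ} {ub : Fin s → ℤ} (he : w (Fin.last _) = 0)
    (ha : ∀ c, w (posA s c).castSucc = p * ua c) (hb : ∀ t, w (posB a t).castSucc = p * ub t) :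
    (∃ x, (blockMatrix p Xa Xk Xb Yb).mulVec x = w) ↔
      ∃ q r : ℤ, w (posK a s).castSucc = p ^ 2 * q + ∑ t, p * Yb t * ub t ∧
        w (posZero a s).castSucc =
          p ^ 3 * r + ∑ c, p * Xa c * ua c + p * Xk * q + ∑ t, p * Xb t * ub t := by
  have hp' : (p : ℤ) ≠ 0 := by exact_mod_cast hp
  have key : ∀ x, (blockMatrix p Xa Xk Xb Yb).mulVec x = w ↔
      x (Fin.last _) = 0 ∧ (∀ c, x (posA s c).castSucc = ua c) ∧
      (∀ t, x (posB a t).castSucc = ub t) ∧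
      w (posK a s).castSucc = p ^ 2 * x (posK a s).castSucc + ∑ t, p * Yb t * ub t ∧
      w (posZero a s).castSucc = p ^ 3 * x (posZero a s).castSucc + ∑ c, p * Xa c * ua c
        + p * Xk * x (posK a s).castSucc + ∑ t, p * Xb t * ub t := by
    intro x
    rw [funext_iff, forall_pos_succ]
    simp only [Matrix.mulVec, dotProduct, sum_pos_succ, blockMatrix, Fin.snoc_castSucc,
      Fin.snoc_last, blockVec_posZero, blockVec_posA, blockVec_posK, blockVec_posB, he, ha, hb,
      Pi.zero_apply, zero_mul, Finset.sum_const_zero, zero_add, one_mul, add_zero,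
      Pi.single_apply, ite_mul, Finset.sum_ite_eq, Finset.mem_univ, if_true]
    constructor
    · rintro ⟨⟨h0, h1, h2, h3⟩, h4⟩
      rw [h4] at h0 h1 h2 h3
      simp only [add_zero, mul_right_inj' hp'] at h0 h1 h2 h3
      simp only [h1, h3] at h0 h2
      exact ⟨h4, h1, h3, h2.symm, h0.symm⟩
    · rintro ⟨h4, h1, h3, h2, h0⟩
      simp only [h4, h1, h3, add_zero, implies_true, h0, h2, and_self]
  simp only [key]
  constructor
  · rintro ⟨x, -, -, -, h1, h2⟩
    exact ⟨_, _, h1, h2⟩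
  · rintro ⟨q, r, h1, h2⟩
    exact ⟨Fin.snoc (α := fun _ => ℤ) (blockVec r ua q ub) 0, by simp [h1, h2]⟩

variable (p Xa Xk Xb Yb) in
/-- The componentwise product of columns `i` and `j` of the block matrix is in the span of the
columns. -/
def ProdInSpan (i j : Fin (1 + a + 1 + s + 1)) : Prop :=
  ∃ x, (blockMatrix p Xa Xk Xb Yb).mulVec x =
    fun r => blockMatrix p Xa Xk Xb Yb r i * blockMatrix p Xa Xk Xb Yb r j

theorem ProdInSpan.symm {i j : Fin (1 + a + 1 + s + 1)} (h : ProdInSpan p Xa Xk Xb Yb i j) :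
    ProdInSpan p Xa Xk Xb Yb j i := by
  simpa only [ProdInSpan, mul_comm] using h

theorem prodInSpan_last (i : Fin (1 + a + 1 + s + 1)) :
    ProdInSpan p Xa Xk Xb Yb i (Fin.last _) := by
  refine ⟨Pi.single i 1, ?_⟩
  funext r
  simp [blockMatrix]

theorem prodInSpan_posZero (hp : p ≠ 0) (j : Fin (1 + a + 1 + s)) :
    ProdInSpan p Xa Xk Xb Yb (posZero a s).castSucc j.castSucc := by
  refine (exists_mulVec_blockMatrix_iff hp (ua := 0) (ub := 0) ?_ ?_ ?_).2
    ⟨0, blockMatrix p Xa Xk Xb Yb (posZero a s).castSucc j.castSucc, ?_, ?_⟩ <;>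
  simp [blockMatrix]

theorem prodInSpan_posA_posA_iff (hp : p ≠ 0) {c c' : Fin a} (h : c ≠ c') :
    ProdInSpan p Xa Xk Xb Yb (posA s c).castSucc (posA s c').castSucc ↔
      (p : ℤ) ∣ Xa c * Xa c' := by
  have hp' : (p : ℤ) ≠ 0 := by exact_mod_cast hp
  rw [ProdInSpan, exists_mulVec_blockMatrix_iff hp (ua := 0) (ub := 0)]
  · simp only [blockMatrix, Fin.snoc_castSucc, blockVec_posZero, blockVec_posA, blockVec_posK,
      Pi.zero_apply, mul_zero, Finset.sum_const_zero, add_zero]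
    constructor
    · rintro ⟨q, r, h1, h2⟩
      have hq : q = 0 := by simpa [hp] using h1.symm
      subst hq
      exact ⟨r, mul_left_cancel₀ (pow_ne_zero 2 hp') (by linear_combination h2)⟩
    · rintro ⟨r, h⟩
      exact ⟨0, r, by ring, by linear_combination (p : ℤ) ^ 2 * h⟩
  · simp [blockMatrix]
  · intro i
    by_cases hi : i = c
    · subst hi
      simp [blockMatrix, h]
    · simp [blockMatrix, hi]
  · simp [blockMatrix]

theorem prodInSpan_posA_self_iff (hp : p ≠ 0) (c : Fin a) :
    ProdInSpan p Xa Xk Xb Yb (posA s c).castSucc (posA s c).castSucc ↔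
      (p : ℤ) ∣ Xa c * Xa c - Xa c := by
  have hp' : (p : ℤ) ≠ 0 := by exact_mod_cast hp
  rw [ProdInSpan, exists_mulVec_blockMatrix_iff hp (ua := Pi.single c p) (ub := 0)]
  · simp only [blockMatrix, Fin.snoc_castSucc, blockVec_posZero, blockVec_posA, blockVec_posK,
      Pi.zero_apply, mul_zero, Finset.sum_const_zero, add_zero, Pi.single_apply, mul_ite,
      Finset.sum_ite_eq', Finset.mem_univ, if_true]
    constructor
    · rintro ⟨q, r, h1, h2⟩
      have hq : q = 0 := by simpa [hp] using h1.symm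
      subst hq
      exact ⟨r, mul_left_cancel₀ (pow_ne_zero 2 hp') (by linear_combination h2)⟩
    · rintro ⟨r, h⟩
      exact ⟨0, r, by ring, by linear_combination (p : ℤ) ^ 2 * h⟩
  · simp [blockMatrix]
  · intro i
    by_cases hi : i = c <;> simp [blockMatrix, hi]
  · simp [blockMatrix]

theorem prodInSpan_posA_posK (hp : p ≠ 0) {Z : ℤ} (hZ : Xk = p * Z) (c : Fin a) :
    ProdInSpan p Xa Xk Xb Yb (posA s c).castSucc (posK a s).castSucc := by
  refine (exists_mulVec_blockMatrix_iff hp (ua := 0) (ub := 0) ?_ ?_ ?_).2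
    ⟨0, Xa c * Z, ?_, ?_⟩ <;> simp [blockMatrix]
  rw [hZ]
  ring

theorem prodInSpan_posA_posB_iff (hp : p ≠ 0) (c : Fin a) (t : Fin s) :
    ProdInSpan p Xa Xk Xb Yb (posA s c).castSucc (posB a t).castSucc ↔
      (p : ℤ) ∣ Xa c * Xb t := by
  have hp' : (p : ℤ) ≠ 0 := by exact_mod_cast hp
  rw [ProdInSpan, exists_mulVec_blockMatrix_iff hp (ua := 0) (ub := 0)]
  · simp only [blockMatrix, Fin.snoc_castSucc, blockVec_posZero, blockVec_posA, blockVec_posK,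
      blockVec_posB, Pi.zero_apply, mul_zero, zero_mul, Finset.sum_const_zero, add_zero]
    constructor
    · rintro ⟨q, r, h1, h2⟩
      have hq : q = 0 := by simpa [hp] using h1.symm
      subst hq
      exact ⟨r, mul_left_cancel₀ (pow_ne_zero 2 hp') (by linear_combination h2)⟩
    · rintro ⟨r, h⟩
      exact ⟨0, r, by ring, by linear_combination (p : ℤ) ^ 2 * h⟩
  all_goals simp [blockMatrix]

theorem dvd_of_prodInSpan_posK_self (hp : p.Prime)
    (h : ProdInSpan p Xa Xk Xb Yb (posK a s).castSucc (posK a s).castSucc) : (p : ℤ) ∣ Xk := by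
  have hp' : (p : ℤ) ≠ 0 := by exact_mod_cast hp.ne_zero
  rw [ProdInSpan, exists_mulVec_blockMatrix_iff hp.ne_zero (ua := 0) (ub := 0)] at h
  · simp only [blockMatrix, Fin.snoc_castSucc, blockVec_posZero, blockVec_posK,
      Pi.zero_apply, mul_zero, Finset.sum_const_zero, add_zero] at h
    obtain ⟨q, r, h1, h2⟩ := h
    have hq : q = p ^ 2 := mul_left_cancel₀ (pow_ne_zero 2 hp') h1.symm
    subst hq
    have h3 : Xk * Xk = p * (r + Xk) :=
      mul_left_cancel₀ (pow_ne_zero 2 hp') (by linear_combination h2)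
    exact (or_self_iff).1 ((Nat.prime_iff_prime_int.1 hp).dvd_or_dvd ⟨_, h3⟩)
  all_goals simp [blockMatrix]

theorem prodInSpan_posK_self (hp : p ≠ 0) {Z : ℤ} (hZ : Xk = p * Z) :
    ProdInSpan p Xa Xk Xb Yb (posK a s).castSucc (posK a s).castSucc := by
  refine (exists_mulVec_blockMatrix_iff hp (ua := 0) (ub := 0) ?_ ?_ ?_).2
    ⟨p ^ 2, p * Z ^ 2 - p * Z, ?_, ?_⟩ <;> simp [blockMatrix]
  rw [hZ]
  ring

theorem prodInSpan_posK_posB (hp : p ≠ 0) {Z : ℤ} (hZ : Xk = p * Z) (t : Fin s) :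
    ProdInSpan p Xa Xk Xb Yb (posK a s).castSucc (posB a t).castSucc := by
  refine (exists_mulVec_blockMatrix_iff hp (ua := 0) (ub := 0) ?_ ?_ ?_).2
    ⟨p * Yb t, Z * Xb t - Z * Yb t, ?_, ?_⟩ <;> simp [blockMatrix]
  rw [hZ]
  ring

theorem prodInSpan_posB_posB_iff (hp : p ≠ 0) {Z : ℤ} (hZ : Xk = p * Z) {t t' : Fin s}
    (h : t ≠ t') :
    ProdInSpan p Xa Xk Xb Yb (posB a t).castSucc (posB a t').castSucc ↔
      (p : ℤ) ∣ Xb t * Xb t' - Z * (Yb t * Yb t') := by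
  have hp' : (p : ℤ) ≠ 0 := by exact_mod_cast hp
  rw [ProdInSpan, exists_mulVec_blockMatrix_iff hp (ua := 0) (ub := 0)]
  · simp only [blockMatrix, Fin.snoc_castSucc, blockVec_posZero, blockVec_posK,
      blockVec_posB, Pi.zero_apply, mul_zero, Finset.sum_const_zero, add_zero, hZ]
    constructor
    · rintro ⟨q, r, h1, h2⟩
      have hq : q = Yb t * Yb t' :=
        mul_left_cancel₀ (pow_ne_zero 2 hp') (by linear_combination -h1)
      subst hq
      exact ⟨r, mul_left_cancel₀ (pow_ne_zero 2 hp') (by linear_combination h2)⟩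
    · rintro ⟨r, h⟩
      exact ⟨Yb t * Yb t', r, by ring, by linear_combination (p : ℤ) ^ 2 * h⟩
  · simp [blockMatrix]
  · simp [blockMatrix]
  · intro i
    by_cases hi : i = t
    · subst hi
      simp [blockMatrix, h]
    · simp [blockMatrix, hi]

theorem prodInSpan_posB_self_iff (hp : p ≠ 0) {Z : ℤ} (hZ : Xk = p * Z) (t : Fin s) :
    ProdInSpan p Xa Xk Xb Yb (posB a t).castSucc (posB a t).castSucc ↔
      (p : ℤ) ∣ Xb t * Xb t - Xb t - Z * (Yb t * Yb t - Yb t) := by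
  have hp' : (p : ℤ) ≠ 0 := by exact_mod_cast hp
  rw [ProdInSpan, exists_mulVec_blockMatrix_iff hp (ua := 0) (ub := Pi.single t p)]
  · simp only [blockMatrix, Fin.snoc_castSucc, blockVec_posZero, blockVec_posK,
      blockVec_posB, Pi.zero_apply, mul_zero, Finset.sum_const_zero, add_zero, hZ,
      Pi.single_apply, mul_ite, Finset.sum_ite_eq', Finset.mem_univ, if_true]
    constructor
    · rintro ⟨q, r, h1, h2⟩
      have hq : q = Yb t * Yb t - Yb t :=
        mul_left_cancel₀ (pow_ne_zero 2 hp') (by linear_combination -h1)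
      subst hq
      exact ⟨r, mul_left_cancel₀ (pow_ne_zero 2 hp') (by linear_combination h2)⟩
    · rintro ⟨r, h⟩
      exact ⟨Yb t * Yb t - Yb t, r, by ring, by linear_combination (p : ℤ) ^ 2 * h⟩
  · simp [blockMatrix]
  · simp [blockMatrix]
  · intro i
    by_cases hi : i = t <;> simp [blockMatrix, hi]

theorem forall_prodInSpan_iff (hp : p.Prime) {Z : ℤ} (hZ : Xk = p * Z) :
    (∀ i j, ProdInSpan p Xa Xk Xb Yb i j) ↔
      haveI := Fact.mk hp
      IsCompat ((Z : ZMod p), (fun c => (Xa c : ZMod p)),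
        fun t => ((Xb t : ZMod p), (Yb t : ZMod p))) := by
  have := Fact.mk hp
  have cast_iff : ∀ x y : ℤ, (x : ZMod p) = y ↔ (p : ℤ) ∣ x - y := fun x y => by
    rw [← sub_eq_zero, ← Int.cast_sub, ZMod.intCast_zmod_eq_zero_iff_dvd]
  have haa : ∀ c, (Xa c : ZMod p) * Xa c = Xa c ↔ (p : ℤ) ∣ Xa c * Xa c - Xa c := fun c => by
    rw [← cast_iff]
    push_cast
    rfl
  have haa' : ∀ c c', (Xa c : ZMod p) * Xa c' = 0 ↔ (p : ℤ) ∣ Xa c * Xa c' := fun c c' => by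
    rw [← ZMod.intCast_zmod_eq_zero_iff_dvd]
    push_cast
    rfl
  have hab : ∀ c t, (Xa c : ZMod p) * Xb t = 0 ↔ (p : ℤ) ∣ Xa c * Xb t := fun c t => by
    rw [← ZMod.intCast_zmod_eq_zero_iff_dvd]
    push_cast
    rfl
  have hbb : ∀ t, OnConic (Z : ZMod p) ((Xb t : ZMod p), (Yb t : ZMod p)) ↔
      (p : ℤ) ∣ Xb t * Xb t - Xb t - Z * (Yb t * Yb t - Yb t) := fun t => by
    rw [← cast_iff]
    push_cast
    rfl
  have hbb' : ∀ t t', IsOrth (Z : ZMod p) ((Xb t : ZMod p), (Yb t : ZMod p))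
      ((Xb t' : ZMod p), (Yb t' : ZMod p)) ↔
      (p : ℤ) ∣ Xb t * Xb t' - Z * (Yb t * Yb t') := fun t t' => by
    rw [← cast_iff]
    push_cast
    rfl
  simp only [IsCompat, IsOrthIdem, haa, haa', hab, hbb, hbb']
  have h0 := hp.ne_zero
  constructor
  · intro h
    exact ⟨⟨fun c => (prodInSpan_posA_self_iff h0 c).1 (h _ _),
      fun c c' hc => (prodInSpan_posA_posA_iff h0 hc).1 (h _ _)⟩,
      fun c t => (prodInSpan_posA_posB_iff h0 c t).1 (h _ _),
      fun t => (prodInSpan_posB_self_iff h0 hZ t).1 (h _ _),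
      fun t t' ht => (prodInSpan_posB_posB_iff h0 hZ ht).1 (h _ _)⟩
  · rintro ⟨⟨h1, h2⟩, h3, h4, h5⟩
    rw [Fin.forall_fin_succ']
    refine ⟨fun i => ?_, fun j => (prodInSpan_last j).symm⟩
    rw [Fin.forall_fin_succ']
    refine ⟨?_, prodInSpan_last _⟩
    revert i
    rw [forall_pos]
    simp only [forall_pos]
    refine ⟨⟨?_, fun c => ?_, ?_, fun t => ?_⟩,
      fun c => ⟨?_, fun c' => ?_, ?_, fun t => ?_⟩,
      ⟨?_, fun c => ?_, ?_, fun t => ?_⟩,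
      fun t => ⟨?_, fun c => ?_, ?_, fun t' => ?_⟩⟩
    · exact prodInSpan_posZero h0 _
    · exact prodInSpan_posZero h0 _
    · exact prodInSpan_posZero h0 _
    · exact prodInSpan_posZero h0 _
    · exact (prodInSpan_posZero h0 _).symm
    · by_cases hc : c = c'
      · subst hc
        exact (prodInSpan_posA_self_iff h0 c).2 (h1 c)
      · exact (prodInSpan_posA_posA_iff h0 hc).2 (h2 c c' hc)
    · exact prodInSpan_posA_posK h0 hZ c
    · exact (prodInSpan_posA_posB_iff h0 c t).2 (h3 c t)
    · exact (prodInSpan_posZero h0 _).symm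
    · exact (prodInSpan_posA_posK h0 hZ c).symm
    · exact prodInSpan_posK_self h0 hZ
    · exact prodInSpan_posK_posB h0 hZ t
    · exact (prodInSpan_posZero h0 _).symm
    · exact ((prodInSpan_posA_posB_iff h0 c t).2 (h3 c t)).symm
    · exact (prodInSpan_posK_posB h0 hZ t).symm
    · by_cases ht : t = t'
      · subst ht
        exact (prodInSpan_posB_self_iff h0 hZ t).2 (h4 t)
      · exact (prodInSpan_posB_posB_iff h0 hZ ht).2 (h5 t t' ht)

end BlockMatrix

section Counting

variable {a s : ℕ} {p : ℕ}

theorem isIrrSubringMatrix_iff {A : Matrix (Fin (1 + a + 1 + s + 1)) (Fin (1 + a + 1 + s + 1)) ℤ} :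
    IsIrrSubringMatrix p (fun i : Fin (1 + a + 1 + s) =>
        if (i : ℕ) = 0 then 3 else if (i : ℕ) = 1 + a then 2 else 1) A ↔
      ∃ (Xa : Fin a → ℤ) (Xk : ℤ) (Xb Yb : Fin s → ℤ), A = blockMatrix p Xa Xk Xb Yb ∧
        (∀ c, 0 ≤ p * Xa c ∧ p * Xa c < (p : ℤ) ^ 3) ∧ (0 ≤ p * Xk ∧ p * Xk < (p : ℤ) ^ 3) ∧
        (∀ t, 0 ≤ p * Xb t ∧ p * Xb t < (p : ℤ) ^ 3) ∧
        (∀ t, 0 ≤ p * Yb t ∧ p * Yb t < (p : ℤ) ^ 2) ∧ ∀ i j, ProdInSpan p Xa Xk Xb Yb i j := by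
  constructor
  · rintro ⟨h1, h2, h3, h4, h5⟩
    have ea : ∀ c, _ := fun c : Fin a => h4 (posZero a s) (posA s c) (by simp)
    have ek := h4 (posZero a s) (posK a s) (by simp)
    have eb : ∀ t, _ := fun t : Fin s => h4 (posZero a s) (posB a t) (by simp)
    have ey : ∀ t, _ := fun t : Fin s => h4 (posK a s) (posB a t) (by simp; omega)
    simp only [val_posZero, val_posK, if_true, if_neg (show ¬ 1 + a = 0 by omega)] at ea ek eb ey
    have hone : ∀ i j : Fin (1 + a + 1 + s), (i : ℕ) ≠ 0 → (i : ℕ) ≠ 1 + a → (i : ℕ) < j →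
        A i.castSucc j.castSucc = 0 := by
      intro i j hi hi' hij
      have h := h4 i j hij
      simp only [if_neg hi, if_neg hi', pow_one] at h
      exact Int.eq_zero_of_dvd_of_nonneg_of_lt h.2.1 h.2.2 h.1
    choose Xa hXa using fun c => (ea c).1
    obtain ⟨Xk, hXk⟩ := ek.1
    choose Xb hXb using fun t => (eb t).1
    choose Yb hYb using fun t => (ey t).1
    have hA : A = blockMatrix p Xa Xk Xb Yb := by
      ext i j
      revert i
      rw [Fin.forall_fin_succ']
      constructor
      · intro i
        revert j
        rw [Fin.forall_fin_succ']
        refine ⟨fun j => ?_, by simp [blockMatrix, h3]⟩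
        revert j
        revert i
        simp only [forall_pos, blockMatrix, Fin.snoc_castSucc, blockVec_posZero, blockVec_posA,
          blockVec_posK, blockVec_posB, hXa, hXk, hXb, hYb, Pi.zero_apply, and_true,
          implies_true]
        refine ⟨by simp [h2], fun c => ⟨h1 _ _ (by simp), fun c' => ?_,
          hone _ _ (by simp) (by simp; omega) (by simp), fun t =>
          hone _ _ (by simp) (by simp; omega) (by simp; omega)⟩,
          ⟨h1 _ _ (by simp), fun c => h1 _ _ (by simp), by simp [h2]⟩,
          fun t => ⟨h1 _ _ (by simp), fun c => h1 _ _ (by simp; omega),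
          h1 _ _ (by simp; omega), fun t' => ?_⟩⟩
        · rcases lt_trichotomy (c : ℕ) c' with h | h | h
          · rw [hone _ _ (by simp) (by simp; omega) (by simpa using h),
              Pi.single_eq_of_ne (Fin.ne_of_val_ne h.ne)]
          · rw [Fin.ext h, h2, Pi.single_eq_same]
            simp [c'.2.ne]
          · rw [h1 _ _ (by simpa using h), Pi.single_eq_of_ne (Fin.ne_of_val_ne h.ne')]
        · rcases lt_trichotomy (t : ℕ) t' with h | h | h
          · rw [hone _ _ (by simp) (by simp; omega) (by simpa using h),
              Pi.single_eq_of_ne (Fin.ne_of_val_ne h.ne)]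
          · rw [Fin.ext h, h2, Pi.single_eq_same]
            simp [show ¬ 1 + a + 1 + (t' : ℕ) = 1 + a by omega]
          · rw [h1 _ _ (by simpa using h), Pi.single_eq_of_ne (Fin.ne_of_val_ne h.ne')]
      · revert j
        rw [Fin.forall_fin_succ']
        exact ⟨fun j => by simpa [blockMatrix] using h1 (Fin.last _) j.castSucc (by simp),
          by simp [blockMatrix, h3]⟩
    refine ⟨Xa, Xk, Xb, Yb, hA, fun c => ?_, ?_, fun t => ?_, fun t => ?_, by subst hA; exact h5⟩
    · exact hXa c ▸ (ea c).2
    · exact hXk ▸ ek.2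
    · exact hXb t ▸ (eb t).2
    · exact hYb t ▸ (ey t).2
  · rintro ⟨Xa, Xk, Xb, Yb, rfl, ha, hk, hb, hy, h⟩
    have hp : (0 : ℤ) < p := by
      rcases Nat.eq_zero_or_pos p with rfl | hp
      · simpa using hk.2
      · exact_mod_cast hp
    refine ⟨?_, ?_, ?_, ?_, h⟩
    · simp only [forall_pos_succ, Fin.val_castSucc, Fin.val_last, blockMatrix,
        Fin.snoc_castSucc, Fin.snoc_last, blockVec_posZero, blockVec_posA, blockVec_posK,
        blockVec_posB, val_posZero, val_posA, val_posK, val_posB, Pi.zero_apply, implies_true,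
        and_true, true_and, Pi.single_apply, Fin.ext_iff]
      grind
    · rw [forall_pos]
      simp [blockMatrix, show ∀ c : Fin a, (c : ℕ) ≠ a from fun c => c.2.ne, add_assoc]
    · simp [blockMatrix]
    · simp only [forall_pos, blockMatrix,
        Fin.snoc_castSucc, blockVec_posZero, blockVec_posA, blockVec_posK,
        blockVec_posB, val_posZero, val_posA, val_posK, val_posB, Pi.zero_apply, dvd_zero,
        le_refl, pow_pos hp, dvd_mul_right, true_and, if_true, ha, hk, hb, implies_true,
        and_self, if_neg (show ¬ 1 + a = 0 by omega), hy, and_true, Pi.single_apply, Fin.ext_iff]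
      refine ⟨fun h => absurd h (lt_irrefl _), fun c c' hc => ?_,
        fun h => absurd h (lt_irrefl _), fun t t' ht => ?_⟩
      · rw [if_neg (show (c : ℕ) ≠ c' by omega)]
        exact ⟨dvd_zero _, le_rfl, pow_pos hp _⟩
      · rw [if_neg (show (t : ℕ) ≠ t' by omega)]
        exact ⟨dvd_zero _, le_rfl, pow_pos hp _⟩

theorem blockMatrix_inj (hp : p ≠ 0) {Xa Xa' : Fin a → ℤ} {Xk Xk' : ℤ} {Xb Xb' Yb Yb' : Fin s → ℤ}
    (h : blockMatrix p Xa Xk Xb Yb = blockMatrix p Xa' Xk' Xb' Yb') :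
    Xa = Xa' ∧ Xk = Xk' ∧ Xb = Xb' ∧ Yb = Yb' := by
  have h0 := fun j : Fin (1 + a + 1 + s) =>
    congrFun (congrFun h (posZero a s).castSucc) j.castSucc
  have hk := fun j : Fin (1 + a + 1 + s) =>
    congrFun (congrFun h (posK a s).castSucc) j.castSucc
  refine ⟨funext fun c => ?_, ?_, funext fun t => ?_, funext fun t => ?_⟩
  · simpa [blockMatrix, hp] using h0 (posA s c)
  · simpa [blockMatrix, hp] using h0 (posK a s)
  · simpa [blockMatrix, hp] using h0 (posB a t)
  · simpa [blockMatrix, hp] using hk (posB a t)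

theorem val_add_mul_inj [NeZero p] {x x' : ZMod p} {w w' : Fin p}
    (h : (x.val : ℤ) + p * (w : ℕ) = x'.val + p * (w' : ℕ)) : x = x' ∧ w = w' := by
  have hx : x = x' := by
    have := congrArg (Int.cast : ℤ → ZMod p) h
    simpa using this
  subst hx
  refine ⟨rfl, Fin.ext ?_⟩
  simpa [NeZero.ne p] using h

theorem exists_val_eq [NeZero p] {X : ℤ} (h : 0 ≤ p * X ∧ p * X < (p : ℤ) ^ 2) :
    ∃ x : ZMod p, (x.val : ℤ) = X := by
  have hp : (0 : ℤ) < p := by exact_mod_cast NeZero.pos p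
  have h0 : 0 ≤ X := nonneg_of_mul_nonneg_right h.1 hp
  have h1 : X < p := lt_of_mul_lt_mul_left (by linarith [h.2, sq (p : ℤ)]) hp.le
  refine ⟨(X : ZMod p), ?_⟩
  rw [ZMod.val_intCast, Int.emod_eq_of_lt h0 h1]

theorem exists_val_add_mul_eq [NeZero p] {X : ℤ} (h : 0 ≤ p * X ∧ p * X < (p : ℤ) ^ 3) :
    ∃ (x : ZMod p) (w : Fin p), (x.val : ℤ) + p * (w : ℕ) = X := by
  have hp : (0 : ℤ) < p := by exact_mod_cast NeZero.pos p
  have h0 : 0 ≤ X := nonneg_of_mul_nonneg_right h.1 hp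
  have h1 : X < p * p := lt_of_mul_lt_mul_left (by linarith [h.2, pow_three (p : ℤ)]) hp.le
  have h2 : X / p < p := Int.ediv_lt_of_lt_mul hp h1
  have h3 : 0 ≤ X / p := Int.ediv_nonneg h0 hp.le
  refine ⟨(X : ZMod p), ⟨(X / p).toNat, by omega⟩, ?_⟩
  rw [ZMod.val_intCast, Int.toNat_of_nonneg h3, Int.emod_add_mul_ediv]

theorem val_range [NeZero p] (x : ZMod p) :
    0 ≤ (p : ℤ) * x.val ∧ (p : ℤ) * x.val < (p : ℤ) ^ 2 := by
  have hp : 0 < p := NeZero.pos p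
  have h := x.val_lt
  refine ⟨by positivity, ?_⟩
  rw [sq]
  exact_mod_cast Nat.mul_lt_mul_of_pos_left h hp

theorem val_add_mul_range [NeZero p] (x : ZMod p) (w : Fin p) :
    0 ≤ (p : ℤ) * (x.val + p * (w : ℕ)) ∧ (p : ℤ) * (x.val + p * (w : ℕ)) < (p : ℤ) ^ 3 := by
  have hp : 0 < p := NeZero.pos p
  have h : x.val + p * w < p * p := by
    have h1 : x.val < p := x.val_lt
    have h2 : p * (w + 1) ≤ p * p := Nat.mul_le_mul_left p w.2
    linarith
  refine ⟨by positivity, ?_⟩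
  rw [pow_three]
  exact_mod_cast Nat.mul_lt_mul_of_pos_left h hp

/-- The irreducible subring matrices are parametrized by the solutions over the residue field
together with arbitrary second digits of the entries of the first row. -/
theorem gMat_eq_natCard_isCompat_mul [Fact p.Prime] :
    gMat p (fun i : Fin (1 + a + 1 + s) =>
        if (i : ℕ) = 0 then 3 else if (i : ℕ) = 1 + a then 2 else 1) =
      Nat.card {g : ZMod p × (Fin a → ZMod p) × (Fin s → ZMod p × ZMod p) // IsCompat g}
        * p ^ (a + s) := by
  have hp : p.Prime := Fact.out
  rw [gMat, natCard_subtype_of_param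
    (fun w : {g : ZMod p × (Fin a → ZMod p) × (Fin s → ZMod p × ZMod p) // IsCompat g} ×
        (Fin a → Fin p) × (Fin s → Fin p) =>
      blockMatrix p (fun c => ((w.1.1.2.1 c).val : ℤ) + p * (w.2.1 c : ℕ))
        (p * (w.1.1.1.val : ℤ))
        (fun t => ((w.1.1.2.2 t).1.val : ℤ) + p * (w.2.2 t : ℕ))
        (fun t => ((w.1.1.2.2 t).2.val : ℤ))),
    Nat.card_prod, Nat.card_prod, Nat.card_fun, Nat.card_fun, pow_add]
  · simp
  · rintro ⟨⟨⟨z, xa, u⟩, hg⟩, wa, wb⟩ ⟨⟨⟨z', xa', u'⟩, hg'⟩, wa', wb'⟩ h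
    obtain ⟨h1, h2, h3, h4⟩ := blockMatrix_inj hp.ne_zero h
    simp only at h1 h2 h3 h4
    have ha := fun c => val_add_mul_inj (congrFun h1 c)
    have hb := fun t => val_add_mul_inj (congrFun h3 t)
    have hy : ∀ t, (u t).2 = (u' t).2 := fun t =>
      ZMod.val_injective p (by exact_mod_cast congrFun h4 t)
    have hz : z = z' := ZMod.val_injective p (by
      exact_mod_cast mul_left_cancel₀ (by exact_mod_cast hp.ne_zero : (p : ℤ) ≠ 0) h2)
    obtain rfl : xa = xa' := funext fun c => (ha c).1
    obtain rfl : wa = wa' := funext fun c => (ha c).2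
    obtain rfl : u = u' := funext fun t => Prod.ext (hb t).1 (hy t)
    obtain rfl : wb = wb' := funext fun t => (hb t).2
    subst hz
    rfl
  · intro A
    rw [isIrrSubringMatrix_iff]
    constructor
    · rintro ⟨Xa, Xk, Xb, Yb, rfl, ha, hk, hb, hy, h⟩
      obtain ⟨Z, hZ⟩ := dvd_of_prodInSpan_posK_self hp (h _ _)
      have hc := (forall_prodInSpan_iff hp hZ).1 h
      have hp' : (0 : ℤ) < p := by exact_mod_cast hp.pos
      obtain ⟨z, hz⟩ : ∃ z : ZMod p, (z.val : ℤ) = Z := by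
        refine exists_val_eq ⟨nonneg_of_mul_nonneg_right (hZ ▸ hk.1) hp', ?_⟩
        have := hk.2
        rw [hZ] at this
        exact lt_of_mul_lt_mul_left (by linarith [pow_succ' (p : ℤ) 2]) hp'.le
      choose xa wa hxa using fun c => exists_val_add_mul_eq (ha c)
      choose xb wb hxb using fun t => exists_val_add_mul_eq (hb t)
      choose yb hyb using fun t => exists_val_eq (hy t)
      refine ⟨⟨⟨(z, xa, fun t => (xb t, yb t)), ?_⟩, wa, wb⟩, ?_⟩
      · simpa [← hxa, ← hxb, ← hyb, ← hz] using hc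
      · simp only [hxa, hxb, hyb, hz, hZ]
    · rintro ⟨⟨⟨⟨z, xa, u⟩, hg⟩, wa, wb⟩, rfl⟩
      refine ⟨_, _, _, _, rfl, fun c => val_add_mul_range _ _, ?_,
        fun t => val_add_mul_range _ _, fun t => val_range _,
        (forall_prodInSpan_iff hp rfl).2 ?_⟩
      · have hp' : (0 : ℤ) < p := by exact_mod_cast hp.pos
        have h := val_range z
        refine ⟨by positivity, ?_⟩
        rw [pow_succ']
        exact mul_lt_mul_of_pos_left h.2 hp'
      · simpa using hg

end Counting

/-- For a prime `p`, `n ≥ 3`, `1 ≤ k ≤ n-2`, let `α` be the composition of length `n-1`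
with first part `3`, with `2` in the `(k+1)`-th position, and all other parts `1`.  Then
`g_α(p) = (n-1)p^{2n-k-5} + (n-k-1)(n-2)p^{n-3}(p-1) - (n-k-1)p^{n-3}
  + ((n-k-2) + C(n-k-2, 2))p^{n-3}(p-2)(p-3)`. -/
theorem gMat_three_two (p : ℕ) (hp : p.Prime) (n k : ℕ) (hn : 3 ≤ n)
    (hk1 : 1 ≤ k) (hkn : k ≤ n - 2) :
    (gMat p (fun i : Fin (n - 1) =>
        if (i : ℕ) = 0 then 3 else if (i : ℕ) = k then 2 else 1) : ℤ) =
      ((n : ℤ) - 1) * (p : ℤ) ^ (2 * n - k - 5)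
        + ((n : ℤ) - k - 1) * ((n : ℤ) - 2) * (p : ℤ) ^ (n - 3) * ((p : ℤ) - 1)
        - ((n : ℤ) - k - 1) * (p : ℤ) ^ (n - 3)
        + (((n : ℤ) - k - 2) + (Nat.choose (n - k - 2) 2 : ℤ)) * (p : ℤ) ^ (n - 3)
            * ((p : ℤ) - 2) * ((p : ℤ) - 3) := by
  have := Fact.mk hp
  obtain ⟨a, rfl⟩ := Nat.exists_eq_add_of_le hk1
  obtain ⟨s, rfl⟩ : ∃ s, n = 1 + a + 1 + s + 1 := ⟨n - (1 + a + 1 + 1), by omega⟩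
  have key := gMat_eq_natCard_isCompat_mul (a := a) (s := s) (p := p)
  refine (congrArg (Nat.cast : ℕ → ℤ) key).trans ?_
  rw [Nat.cast_mul, natCard_isCompat (ZMod.card p),
    show 2 * (1 + a + 1 + s + 1) - (1 + a) - 5 = s + (a + s) by omega,
    show 1 + a + 1 + s + 1 - 3 = a + s by omega,
    show 1 + a + 1 + s + 1 - (1 + a) - 2 = s by omega]
  push_cast
  ring
end

section
/- Let $p$ be a prime, let $n\ge 3$, let $1\le k\le n-2$ and $\beta>2$, and let $\alpha$ be the composition of length $n-1$ with first part $3$, with $\beta$ in the $(k+1)$-th position, and all other parts $1$. Then $g_\alpha(p) = (n-k-1)(n-2)p^{2n-k-5} + \left((n-k-1)(k-1)+1+(n-k-2)(n-k-3)\right)p^{n-3}(p-1) + (n-k-2)p^{n-3}(p-1)^2 + (n-k-2)p^{n-2}(p-1) + (n-k-2)(n-k-3)p^{n-3}(p-1)(p-2)$. -/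
/-- The functions `u` supported on at most one point, with nonzero values in prescribed sets. -/
theorem card_supported_at_most_once {ι R : Type*} [Fintype ι] [DecidableEq ι] [DecidableEq R]
    [Zero R] (T : ι → Finset R) (hT : ∀ i, 0 ∉ T i) :
    Nat.card {u : ι → R // (∀ i j, i ≠ j → u i = 0 ∨ u j = 0) ∧ ∀ i, u i = 0 ∨ u i ∈ T i} =
      1 + ∑ i, (T i).card := by
  classical
  let f : Option (Σ i, T i) →
      {u : ι → R // (∀ i j, i ≠ j → u i = 0 ∨ u j = 0) ∧ ∀ i, u i = 0 ∨ u i ∈ T i} := fun x =>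
    match x with
    | none => ⟨0, by simp, by simp⟩
    | some ⟨i, x⟩ => ⟨Pi.single i x, by
        intro a b hab
        by_cases ha : a = i
        · subst ha; right; simp [hab.symm]
        · left; simp [ha], by
        intro a
        by_cases ha : a = i
        · subst ha; right; simp
        · left; simp [ha]⟩
  have hne : ∀ i (x : T i), (x : R) ≠ 0 := fun i x h => hT i (h ▸ x.2)
  have hf : Function.Bijective f := by
    constructor
    · rintro (_ | ⟨i, x⟩) (_ | ⟨j, y⟩) h
      · rfl
      · have := congrFun (congrArg Subtype.val h) j
        simp only [f, Pi.zero_apply, Pi.single_eq_same] at this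
        exact absurd this.symm (hne j y)
      · have := congrFun (congrArg Subtype.val h) i
        simp only [f, Pi.zero_apply, Pi.single_eq_same] at this
        exact absurd this (hne i x)
      · have := congrFun (congrArg Subtype.val h) i
        simp only [f, Pi.single_eq_same] at this
        by_cases hij : i = j
        · subst hij
          simp only [Pi.single_eq_same] at this
          rw [Subtype.ext this]
        · simp only [Pi.single_eq_of_ne hij] at this
          exact absurd this (hne i x)
    · rintro ⟨u, h1, h2⟩
      by_cases hu : ∃ i, u i ≠ 0
      · obtain ⟨i, hi⟩ := hu
        refine ⟨some ⟨i, u i, (h2 i).resolve_left hi⟩, Subtype.ext (funext fun j => ?_)⟩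
        by_cases hij : j = i
        · subst hij; simp [f]
        · simp only [f, Pi.single_eq_of_ne hij]
          exact ((h1 j i hij).resolve_right hi).symm
      · push Not at hu
        exact ⟨none, Subtype.ext (funext fun j => (hu j).symm)⟩
  rw [← Nat.card_congr (Equiv.ofBijective f hf), Nat.card_eq_fintype_card, Fintype.card_option,
    Fintype.card_sigma, add_comm]
  simp

section Residues

variable {O F : Type*} [DecidableEq O] [Field F]

/-- The multiplicative conditions on the residues of the entries of a subring matrix: `u` and `y`
come from the first row, `w` and the distinguished index `l` from the row of `β`. -/
def ResidueCond (J : Finset O) (y : F) (l : Option J) (u w : O → F) : Prop :=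
  (∀ i ∉ J, w i = 0) ∧
  (∀ i, u i ^ 2 - u i = y * if l.unattach = some i then w i else -w i) ∧
  ∀ i j, i ≠ j → u i * u j =
    y * ((if l.unattach = some i then w j else 0) + (if l.unattach = some j then w i else 0))

variable [Fintype O] [Fintype F] (J : Finset O)

theorem sum_if_mem_card (a b : ℤ) :
    ∑ i : O, (if i ∈ J then a else b) = J.card * a + (Fintype.card O - J.card) * b := by
  rw [Finset.sum_ite]
  have h1 : (Finset.univ.filter (· ∈ J)) = J := by ext; simp
  have h2 : (Finset.univ.filter (· ∉ J)) = Jᶜ := by ext; simp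
  rw [h1, h2, Finset.sum_const, Finset.sum_const, Finset.card_compl,
    nsmul_eq_mul, nsmul_eq_mul, Nat.cast_sub J.card_le_univ]

theorem card_vanishing_off :
    Nat.card {w : O → F // ∀ i ∉ J, w i = 0} = Fintype.card F ^ J.card := by
  classical
  have h : {w : O → F // ∀ i ∉ J, w i = 0} ≃
      (Fintype.piFinset fun i => if i ∈ J then (Finset.univ : Finset F) else {0}) :=
    Equiv.subtypeEquivRight fun w => by
      rw [Fintype.mem_piFinset]
      refine forall_congr' fun i => ?_
      by_cases hi : i ∈ J <;> simp [hi]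
  rw [Nat.card_congr h, Nat.card_eq_fintype_card, Fintype.card_coe, Fintype.card_piFinset,
    ← Finset.prod_const]
  rw [← Finset.prod_subset (Finset.subset_univ J)]
  · exact Finset.prod_congr rfl fun i hi => by simp [hi]
  · intro i _ hi
    simp [hi]

variable [DecidableEq F]

theorem card_residueCond_zero (l : Option J) :
    Nat.card {d : (O → F) × (O → F) // ResidueCond J 0 l d.1 d.2} =
      (1 + Fintype.card O) * Fintype.card F ^ J.card := by
  have h : {d : (O → F) × (O → F) // ResidueCond J 0 l d.1 d.2} ≃
      {d : (O → F) × (O → F) // ((∀ i j, i ≠ j → d.1 i = 0 ∨ d.1 j = 0) ∧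
        ∀ i, d.1 i = 0 ∨ d.1 i ∈ ({1} : Finset F)) ∧ ∀ i ∉ J, d.2 i = 0} :=
    Equiv.subtypeEquivRight fun d => by
      simp only [ResidueCond, zero_mul, mul_eq_zero, Finset.mem_singleton]
      have : ∀ i, d.1 i ^ 2 - d.1 i = 0 ↔ d.1 i = 0 ∨ d.1 i = 1 := fun i => by
        rw [show d.1 i ^ 2 - d.1 i = d.1 i * (d.1 i - 1) by ring, mul_eq_zero, sub_eq_zero]
      simp only [this]
      tauto
  rw [Nat.card_congr h, Nat.card_congr (Equiv.subtypeProdEquivProd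
    (p := fun u : O → F => (∀ i j, i ≠ j → u i = 0 ∨ u j = 0) ∧
        ∀ i, u i = 0 ∨ u i ∈ ({1} : Finset F)) (q := fun w : O → F => ∀ i ∉ J, w i = 0)),
    Nat.card_prod, card_vanishing_off, card_supported_at_most_once (fun _ => {1}) (by simp)]
  simp

theorem card_residueCond_none {y : F} (hy : y ≠ 0) :
    (Nat.card {d : (O → F) × (O → F) // ResidueCond J y none d.1 d.2} : ℤ) =
      1 + J.card * (Fintype.card F - 1) + (Fintype.card O - J.card) := by
  let T : O → Finset F := fun i => if i ∈ J then Finset.univ.erase 0 else {1}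
  have hT : ∀ i, 0 ∉ T i := fun i => by by_cases hi : i ∈ J <;> simp [T, hi]
  have hTm : ∀ i x, x = 0 ∨ x ∈ T i ↔ i ∈ J ∨ x ^ 2 - x = 0 := fun i x => by
    rw [show x ^ 2 - x = x * (x - 1) by ring, mul_eq_zero, sub_eq_zero]
    by_cases hi : i ∈ J <;> simp [T, hi, em]
  let f : {d : (O → F) × (O → F) // ResidueCond J y none d.1 d.2} →
      {u : O → F // (∀ i j, i ≠ j → u i = 0 ∨ u j = 0) ∧ ∀ i, u i = 0 ∨ u i ∈ T i} := fun d =>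
    ⟨d.1.1, fun i j hij => by simpa using d.2.2.2 i j hij, fun i => by
      rw [hTm]
      by_cases hi : i ∈ J
      · exact .inl hi
      · right; rw [d.2.2.1 i]; simp [d.2.1 i hi]⟩
  have hf : Function.Bijective f := by
    constructor
    · rintro ⟨⟨u, w⟩, h⟩ ⟨⟨u', w'⟩, h'⟩ e
      have e1 : u = u' := congrArg Subtype.val e
      subst e1
      have : w = w' := funext fun i => by
        have := (h.2.1 i).symm.trans (h'.2.1 i)
        simpa [hy] using this
      exact Subtype.ext (Prod.ext rfl this)
    · rintro ⟨u, h1, h2⟩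
      refine ⟨⟨⟨u, fun i => -(u i ^ 2 - u i) / y⟩, fun i hi => ?_, fun i => ?_,
        fun i j hij => ?_⟩, rfl⟩
      · simp [((hTm i (u i)).1 (h2 i)).resolve_left hi]
      · simp; field_simp; ring
      · simpa using h1 i j hij
  rw [Nat.card_congr (Equiv.ofBijective f hf), card_supported_at_most_once T hT]
  have : ∀ i, ((T i).card : ℤ) = if i ∈ J then (Fintype.card F : ℤ) - 1 else 1 := fun i => by
    by_cases hi : i ∈ J
    · simp [T, hi, Finset.card_erase_of_mem, Finset.card_univ, Nat.cast_pred Fintype.card_pos]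
    · simp [T, hi]
  push_cast
  rw [Finset.sum_congr rfl fun i _ => this i, sum_if_mem_card]
  ring

theorem card_residueCond_some {y : F} (hy : y ≠ 0) (l : J) :
    (Nat.card {d : (O → F) × (O → F) // ResidueCond J y (some l) d.1 d.2} : ℤ) =
      Fintype.card F + (J.card - 1) * (Fintype.card F - 1) + (Fintype.card O - J.card) := by
  let T : F → {i : O // i ≠ l} → Finset F := fun s i =>
    if i.1 ∈ J ∨ s = 0 then {1 - s} \ {0} else ∅
  have hT : ∀ s i, 0 ∉ T s i := fun s i => by
    by_cases hi : i.1 ∈ J ∨ s = 0 <;> simp [T, hi]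
  have hTm : ∀ s i x, x = 0 ∨ x ∈ T s i ↔ x = 0 ∨ ((i.1 ∈ J ∨ s = 0) ∧ x = 1 - s) :=
      fun s i x => by
    by_cases hx : x = 0
    · simp [hx]
    · by_cases hi : i.1 ∈ J ∨ s = 0 <;> simp [T, hi, hx]
  let f : {d : (O → F) × (O → F) // ResidueCond J y (some l) d.1 d.2} → Σ s : F,
      {u : {i : O // i ≠ l} → F // (∀ i j, i ≠ j → u i = 0 ∨ u j = 0) ∧
        ∀ i, u i = 0 ∨ u i ∈ T s i} := fun d =>
    ⟨d.1.1 l, fun i => d.1.1 i, fun i j hij => by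
      have := d.2.2.2 i j (fun h => hij (Subtype.ext h))
      simpa [i.2.symm, j.2.symm] using this, fun i => by
      have h1 := d.2.2.2 i l i.2
      have h2 := d.2.2.1 i
      have h3 := d.2.1 i
      simp only [Option.unattach_some, Option.some.injEq, i.2.symm, if_false, if_true] at h1 h2
      rw [hTm, or_iff_not_imp_left]
      intro h0
      have h4 : d.1.1 i = 1 - d.1.1 l := by
        have : d.1.1 i * (d.1.1 i - (1 - d.1.1 l)) = 0 := by linear_combination h1 + h2
        exact sub_eq_zero.1 ((mul_eq_zero.1 this).resolve_left h0)
      refine ⟨?_, h4⟩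
      by_contra! hc
      rw [h3 hc.1] at h1
      simp [h0, hc.2] at h1⟩
  have hf : Function.Bijective f := by
    constructor
    · rintro ⟨⟨u, w⟩, h⟩ ⟨⟨u', w'⟩, h'⟩ e
      obtain ⟨e1, e2⟩ := Sigma.mk.inj_iff.1 e
      have e3 : u = u' := by
        funext i
        by_cases hi : i = l
        · rw [hi]; exact e1
        · simp only at e1
          have e4 : (f ⟨⟨u, w⟩, h⟩).2.1 = (f ⟨⟨u', w'⟩, h'⟩).2.1 := by rw [e]
          exact congrFun e4 ⟨i, hi⟩
      subst e3
      have : w = w' := funext fun i => by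
        have := (h.2.1 i).symm.trans (h'.2.1 i)
        by_cases hi : (l : O) = i <;> simpa [hy, hi] using this
      exact Subtype.ext (Prod.ext rfl this)
    · rintro ⟨s, u, h1, h2⟩
      let v : O → F := fun i => if h : i = l then s else u ⟨i, h⟩
      have hvl : v l = s := by simp [v]
      have hv : ∀ (i : O) (h : i ≠ l), v i = u ⟨i, h⟩ := fun i h => by simp [v, h]
      have key : ∀ i : O, i ≠ l → v i * v l = -(v i ^ 2 - v i) := fun i hi => by
        rcases (hTm s ⟨i, hi⟩ _).1 (h2 ⟨i, hi⟩) with h | h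
        · rw [hv i hi, h]; simp
        · rw [hv i hi, h.2, hvl]; ring
      refine ⟨⟨⟨v, fun i => (if (l : O) = i then 1 else -1) * (v i ^ 2 - v i) / y⟩,
        fun i hi => ?_, fun i => ?_, fun i j hij => ?_⟩, ?_⟩
      · have hil : i ≠ l := fun h => hi (h ▸ l.2)
        have : v i ^ 2 - v i = 0 := by
          rw [hv i hil]
          rcases (hTm s ⟨i, hil⟩ _).1 (h2 ⟨i, hil⟩) with h | h
          · rw [h]; simp
          · rw [h.2, h.1.resolve_left hi]; simp
        simp [this]
      · by_cases hi : (l : O) = i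
        · simp only [Option.unattach_some, hi, if_true]
          field_simp
        · simp only [Option.unattach_some, Option.some.injEq, hi, if_false]
          field_simp
      · by_cases hi : (l : O) = i
        · have hj : (l : O) ≠ j := fun h => hij (hi.symm.trans h)
          simp only [Option.unattach_some, Option.some.injEq, if_pos hi, if_neg hj, add_zero]
          have := key j hj.symm
          field_simp
          rw [← hi]
          linear_combination this
        · by_cases hj : (l : O) = j
          · simp only [Option.unattach_some, Option.some.injEq, if_neg hi, if_pos hj, zero_add]
            have := key i (Ne.symm hi)
            field_simp
            rw [← hj]
            linear_combination this
          · simp only [Option.unattach_some, Option.some.injEq, if_neg hi, if_neg hj,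
              add_zero, mul_zero]
            rw [hv i (Ne.symm hi), hv j (Ne.symm hj), mul_eq_zero]
            exact h1 _ _ (fun h => hij (congrArg Subtype.val h))
      · have e : (fun i : {i : O // i ≠ l} => v i) = u := funext fun i => hv i i.2
        exact Sigma.subtype_ext hvl e
  have hc : ∀ i, ∑ s, ((T s i).card : ℤ) =
      if i.1 ∈ J then (Fintype.card F : ℤ) - 1 else 1 := fun i => by
    by_cases hi : i.1 ∈ J
    · have : ∀ s, ((T s i).card : ℤ) = 1 - if s = 1 then 1 else 0 := fun s => by
        by_cases hs : s = 1
        · simp [T, hi, hs]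
        · have : ({1 - s} : Finset F) \ {0} = {1 - s} := by
            rw [Finset.sdiff_singleton_eq_erase, Finset.erase_eq_of_notMem]
            simpa [eq_comm, sub_eq_zero] using fun h : 0 = 1 - s => hs (sub_eq_zero.1 h.symm).symm
          simp [T, hi, hs, this]
      simp [this, hi]
    · have : ∀ s, ((T s i).card : ℤ) = if s = 0 then 1 else 0 := fun s => by
        by_cases hs : s = 0
        · have : ({1} : Finset F) \ {0} = {1} := by
            rw [Finset.sdiff_singleton_eq_erase, Finset.erase_eq_of_notMem]
            simp
          simp [T, hs, this]
        · simp [T, hi, hs]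
      simp [this, hi]
  have hsum : ∑ i : {i : O // i ≠ l}, (if i.1 ∈ J then (Fintype.card F : ℤ) - 1 else 1) =
      (J.card - 1) * (Fintype.card F - 1) + (Fintype.card O - J.card) := by
    have h := sum_if_mem_card J ((Fintype.card F : ℤ) - 1) 1
    rw [Fintype.sum_eq_add_sum_subtype_ne _ (l : O), if_pos l.2] at h
    linear_combination h
  rw [Nat.card_congr (Equiv.ofBijective f hf), Nat.card_sigma]
  simp_rw [fun s => card_supported_at_most_once (T s) (hT s)]
  push_cast
  rw [Finset.sum_add_distrib, Finset.sum_comm, Finset.sum_congr rfl fun i _ => hc i, hsum]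
  simp
  ring

theorem card_residueCond :
    (Nat.card {d : (F × Option J) × ((O → F) × (O → F)) //
        ResidueCond J d.1.1 d.1.2 d.2.1 d.2.2} : ℤ) =
      (J.card + 1) * ((1 + Fintype.card O) * (Fintype.card F : ℤ) ^ J.card) +
      (Fintype.card F - 1) * (1 + J.card * (Fintype.card F - 1) + (Fintype.card O - J.card) +
        J.card * (Fintype.card F + (J.card - 1) * (Fintype.card F - 1) +
          (Fintype.card O - J.card))) := by
  rw [Nat.card_congr (Equiv.subtypeProdEquivSigmaSubtype
    (fun (yl : F × Option J) (d : (O → F) × (O → F)) => ResidueCond J yl.1 yl.2 d.1 d.2)),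
    Nat.card_sigma, Fintype.sum_prod_type, Nat.cast_sum,
    Fintype.sum_eq_add_sum_subtype_ne _ (0 : F)]
  congr 1
  · simp_rw [card_residueCond_zero]
    simp
  · have h : ∀ y : {y : F // y ≠ 0}, ((∑ l : Option J, Nat.card {d : (O → F) × (O → F) //
        ResidueCond J y.1 l d.1 d.2} : ℕ) : ℤ) =
        1 + J.card * (Fintype.card F - 1) + (Fintype.card O - J.card) +
        J.card * (Fintype.card F + (J.card - 1) * (Fintype.card F - 1) +
          (Fintype.card O - J.card)) := fun y => by
      rw [Fintype.sum_option]
      push_cast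
      rw [card_residueCond_none J y.2]
      simp_rw [card_residueCond_some J y.2]
      simp
    have hF : Fintype.card {y : F // y ≠ 0} = Fintype.card F - 1 := by simp
    rw [Finset.sum_congr rfl fun y _ => h y, Finset.sum_const, nsmul_eq_mul, Finset.card_univ,
      hF, Nat.cast_pred Fintype.card_pos]

end Residues

section Entries

variable {O : Type*} [DecidableEq O]

/-- The conditions satisfied by the nontrivial entries of a subring matrix: `d.1` and `d.2.1` are
the entries of the first row, `d.2.2` those of the row of `β`. -/
def EntryCond (p β : ℕ) (J : Finset O) (d : ℤ × (O → ℤ) × (O → ℤ)) : Prop :=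
  ((p : ℤ) ∣ d.1 ∧ 0 ≤ d.1 ∧ d.1 < (p : ℤ) ^ 3) ∧
  (∀ i, (p : ℤ) ∣ d.2.1 i ∧ 0 ≤ d.2.1 i ∧ d.2.1 i < (p : ℤ) ^ 3) ∧
  (∀ i ∈ J, (p : ℤ) ∣ d.2.2 i ∧ 0 ≤ d.2.2 i ∧ d.2.2 i < (p : ℤ) ^ β) ∧
  (∀ i ∉ J, d.2.2 i = 0) ∧
  (∃ c c' : ℤ, (p : ℤ) ^ β * (p : ℤ) ^ β = (p : ℤ) ^ β * c ∧
    d.1 * d.1 = (p : ℤ) ^ 3 * c' + d.1 * c) ∧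
  (∀ i, ∃ c c' : ℤ, (p : ℤ) ^ β * d.2.2 i = (p : ℤ) ^ β * c ∧
    d.1 * d.2.1 i = (p : ℤ) ^ 3 * c' + d.1 * c) ∧
  ∀ i j, ∃ c c' : ℤ,
    d.2.2 i * d.2.2 j = (p : ℤ) ^ β * c + (if i = j then (p : ℤ) * d.2.2 i else 0) ∧
    d.2.1 i * d.2.1 j = (p : ℤ) ^ 3 * c' + d.1 * c + (if i = j then (p : ℤ) * d.2.1 i else 0)

/-- The entries of a matrix recovered from their residues; the last component is the part of the
first row which is not constrained. -/
def entriesOfResidues (p s : ℕ) (J : Finset O)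
    (d : ((ZMod p × Option J) × ((O → ZMod p) × (O → ZMod p))) × (O → ZMod p)) :
    ℤ × (O → ℤ) × (O → ℤ) :=
  ((p : ℤ) ^ 2 * d.1.1.1.val,
    fun i => p * ((d.1.2.1 i).val + p * (d.2 i).val),
    fun i => p * ((if d.1.1.2.unattach = some i then 1 else 0) + p ^ (s + 1) * (d.1.2.2 i).val))

variable {p : ℕ} [hp : Fact p.Prime]

theorem exists_reduction_iff {P : ℤ} (hP : P ≠ 0) (y X C : ℤ) :
    (∃ c c' : ℤ, (p : ℤ) ^ 2 * (P * C) = (p : ℤ) ^ 2 * P * c ∧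
      (p : ℤ) ^ 2 * X = (p : ℤ) ^ 3 * c' + (p : ℤ) ^ 2 * y * c) ↔ (X : ZMod p) = y * C := by
  have hp0 : (p : ℤ) ^ 2 ≠ 0 := pow_ne_zero _ (Int.natCast_ne_zero.2 hp.out.ne_zero)
  rw [← sub_eq_zero, ← Int.cast_mul, ← Int.cast_sub, ZMod.intCast_zmod_eq_zero_iff_dvd]
  constructor
  · rintro ⟨c, c', h1, h2⟩
    rw [← mul_assoc] at h1
    have h3 := mul_left_cancel₀ (mul_ne_zero hp0 hP) h1
    subst h3
    refine ⟨c', mul_left_cancel₀ hp0 ?_⟩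
    linear_combination h2
  · rintro ⟨c', h⟩
    exact ⟨C, c', by ring, by linear_combination (p : ℤ) ^ 2 * h⟩

theorem val_lt_coe (x : ZMod p) : (x.val : ℤ) < p := by
  exact_mod_cast ZMod.val_lt x

theorem val_intCast_of_lt {z : ℤ} (h0 : 0 ≤ z) (h : z < p) : (((z : ZMod p).val : ℕ) : ℤ) = z := by
  rw [ZMod.val_intCast, Int.emod_eq_of_lt h0 h]

theorem entriesOfResidues_injective (s : ℕ) (J : Finset O) :
    Function.Injective (entriesOfResidues p s J) := by
  have hp0 : (p : ℤ) ≠ 0 := Int.natCast_ne_zero.2 hp.out.ne_zero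
  rintro ⟨⟨⟨y, l⟩, u, w⟩, t⟩ ⟨⟨⟨y', l'⟩, u', w'⟩, t'⟩ h
  simp only [entriesOfResidues, Prod.mk.injEq] at h ⊢
  obtain ⟨h1, h2, h3⟩ := h
  have hval : ∀ x x' : ZMod p, (x.val : ℤ) = x'.val → x = x' := fun x x' h =>
    ZMod.val_injective p (by exact_mod_cast h)
  have hu : ∀ i, u i = u' i ∧ t i = t' i := fun i => by
    have e := mul_left_cancel₀ hp0 (congrFun h2 i)
    have e1 : u i = u' i := by
      simpa using congrArg (Int.cast : ℤ → ZMod p) e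
    refine ⟨e1, hval _ _ (mul_left_cancel₀ hp0 ?_)⟩
    rw [e1] at e
    linarith
  have hw : ∀ i, (l.unattach = some i ↔ l'.unattach = some i) ∧ w i = w' i := fun i => by
    have e := mul_left_cancel₀ hp0 (congrFun h3 i)
    have e1 : (l.unattach = some i ↔ l'.unattach = some i) := by
      have := congrArg (Int.cast : ℤ → ZMod p) e
      by_cases h : l.unattach = some i <;> by_cases h' : l'.unattach = some i <;>
        simp [h, h'] at this ⊢
    refine ⟨e1, hval _ _ (mul_left_cancel₀ (pow_ne_zero (s + 1) hp0) ?_)⟩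
    simp only [e1] at e
    linarith
  refine ⟨⟨⟨hval _ _ (mul_left_cancel₀ (pow_ne_zero 2 hp0) h1), ?_⟩, funext fun i => (hu i).1,
    funext fun i => (hw i).2⟩, funext fun i => (hu i).2⟩
  refine Option.map_injective Subtype.val_injective (Option.ext fun i => ?_)
  exact (hw i).1

theorem entryCond_entriesOfResidues_iff (s : ℕ) (J : Finset O) (y : ZMod p) (l : Option J)
    (u w t : O → ZMod p) (hw : ∀ i ∉ J, w i = 0) :
    EntryCond p (s + 3) J (entriesOfResidues p s J (((y, l), u, w), t)) ↔
      ResidueCond J y l u w := by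
  have hp0 : (p : ℤ) ≠ 0 := Int.natCast_ne_zero.2 hp.out.ne_zero
  have hp2 : (2 : ℤ) ≤ p := by exact_mod_cast hp.out.two_le
  have hpp : (0 : ℤ) < p ^ (s + 1) := by positivity
  have hpp2 : (2 : ℤ) ≤ p ^ (s + 1) := by
    rw [pow_succ]
    nlinarith [one_le_pow₀ (show (1 : ℤ) ≤ p by linarith) (n := s)]
  have hv0 : ∀ x : ZMod p, (0 : ℤ) ≤ x.val := fun x => by positivity
  have hv1 : ∀ x : ZMod p, (x.val : ℤ) ≤ p - 1 := fun x => by have := val_lt_coe x; linarith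
  let x : O → ℤ := fun i => (u i).val + p * (t i).val
  let δ : O → ℤ := fun i => if l.unattach = some i then 1 else 0
  let z : O → ℤ := fun i => δ i + p ^ (s + 1) * (w i).val
  have hδ : ∀ i, δ i = 0 ∨ δ i = 1 := fun i => by
    by_cases h : l.unattach = some i <;> simp [δ, h]
  have hδJ : ∀ i ∉ J, δ i = 0 := fun i hi => by
    refine if_neg fun h => hi ?_
    obtain ⟨a, -, h⟩ := Option.map_eq_some_iff.1 (Option.unattach.eq_1 l ▸ h)
    exact h ▸ a.2
  have hδδ : ∀ i j, i ≠ j → δ i * δ j = 0 := fun i j hij => by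
    by_cases h : l.unattach = some i
    · have : ¬ l.unattach = some j := fun h' => hij (Option.some.inj (h.symm.trans h'))
      simp [δ, this]
    · simp [δ, h]
  have hx : ∀ i, ((x i : ℤ) : ZMod p) = u i := fun i => by simp [x]
  have hy : (((y.val : ℕ) : ℤ) : ZMod p) = y := by simp
  have hdiag : ∀ i, (∃ c c' : ℤ,
      p * z i * (p * z i) = (p : ℤ) ^ (s + 3) * c + p * (p * z i) ∧
      p * x i * (p * x i) = (p : ℤ) ^ 3 * c' + (p : ℤ) ^ 2 * y.val * c + p * (p * x i)) ↔
      u i ^ 2 - u i = y * if l.unattach = some i then w i else -w i := fun i => by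
    have h := exists_reduction_iff (p := p) hpp.ne' y.val (x i ^ 2 - x i)
      ((w i).val * (p ^ (s + 1) * (w i).val + 2 * δ i - 1))
    have e : (p : ℤ) ^ (s + 1) * ((w i).val * (p ^ (s + 1) * (w i).val + 2 * δ i - 1)) =
        z i ^ 2 - z i := by
      rcases hδ i with h | h <;> simp only [z, h] <;> ring
    have e' : ((((w i).val : ℤ) * (p ^ (s + 1) * (w i).val + 2 * δ i - 1) : ℤ) : ZMod p) =
        if l.unattach = some i then w i else -w i := by
      by_cases h : l.unattach = some i
      · simp [δ, h]; ring
      · simp [δ, h]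
    rw [e, e', hy] at h
    push_cast at h
    rw [← hx i, ← h]
    refine exists_congr fun c => exists_congr fun c' => and_congr ?_ ?_ <;>
      constructor <;> intro h <;> linear_combination h
  have hoff : ∀ i j, i ≠ j → ((∃ c c' : ℤ,
      p * z i * (p * z j) = (p : ℤ) ^ (s + 3) * c ∧
      p * x i * (p * x j) = (p : ℤ) ^ 3 * c' + (p : ℤ) ^ 2 * y.val * c) ↔
      u i * u j = y * ((if l.unattach = some i then w j else 0) +
        (if l.unattach = some j then w i else 0))) := fun i j hij => by
    have h := exists_reduction_iff (p := p) hpp.ne' y.val (x i * x j)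
      (δ i * (w j).val + δ j * (w i).val + p ^ (s + 1) * (w i).val * (w j).val)
    have e : (p : ℤ) ^ (s + 1) *
        (δ i * (w j).val + δ j * (w i).val + p ^ (s + 1) * (w i).val * (w j).val) =
        z i * z j := by
      simp only [z]
      linear_combination -hδδ i j hij
    have e' : ((δ i * (w j).val + δ j * (w i).val + p ^ (s + 1) * (w i).val * (w j).val : ℤ) :
        ZMod p) = (if l.unattach = some i then w j else 0) +
        (if l.unattach = some j then w i else 0) := by
      simp [δ]
    rw [e, e', hy] at h
    push_cast at h
    rw [← hx i, ← hx j, ← h]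
    refine exists_congr fun c => exists_congr fun c' => and_congr ?_ ?_ <;>
      constructor <;> intro h <;> linear_combination h
  constructor
  · rintro ⟨-, -, -, -, -, -, h⟩
    refine ⟨hw, fun i => (hdiag i).1 ?_, fun i j hij => (hoff i j hij).1 ?_⟩
    · have := h i i
      simp only [if_true] at this
      exact this
    · have := h i j
      simp only [if_neg hij, add_zero] at this
      exact this
  · rintro ⟨-, h1, h2⟩
    refine ⟨⟨⟨p * y.val, ?_⟩, ?_, ?_⟩, fun i => ⟨⟨x i, rfl⟩, ?_, ?_⟩,
      fun i hi => ⟨⟨z i, rfl⟩, ?_, ?_⟩, fun i hi => ?_,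
      ⟨p ^ (s + 3), p * y.val ^ 2 - y.val * p ^ (s + 2), rfl, ?_⟩,
      fun i => ⟨p * z i, y.val * x i - y.val * z i, rfl, ?_⟩, fun i j => ?_⟩
    · simp only [entriesOfResidues]; ring
    · exact mul_nonneg (by positivity) (hv0 _)
    · simp only [entriesOfResidues]
      rw [pow_succ]
      exact mul_lt_mul_of_pos_left (val_lt_coe y) (by positivity)
    · exact mul_nonneg (by positivity) (add_nonneg (hv0 _) (mul_nonneg (by positivity) (hv0 _)))
    · have : (p : ℤ) * x i < p * p ^ 2 := by
        refine mul_lt_mul_of_pos_left ?_ (by linarith)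
        simp only [x]
        nlinarith [hv1 (u i), hv1 (t i)]
      calc _ = (p : ℤ) * x i := rfl
        _ < _ := this
        _ = _ := by ring
    · refine mul_nonneg (by positivity) (add_nonneg ?_ (mul_nonneg hpp.le (hv0 _)))
      rcases hδ i with h | h
      · exact h.ge
      · exact zero_le_one.trans h.ge
    · have : (p : ℤ) * z i < p * (p * p ^ (s + 1)) := by
        refine mul_lt_mul_of_pos_left ?_ (by linarith)
        simp only [z]
        rcases hδ i with h | h <;> rw [h] <;> nlinarith [hv1 (w i)]
      calc _ = (p : ℤ) * z i := rfl
        _ < _ := this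
        _ = _ := by ring
    · have := hδJ i hi
      simp only [δ] at this
      simp only [entriesOfResidues, this, hw i hi]
      simp
    · simp only [entriesOfResidues]; ring
    · simp only [entriesOfResidues, x, z, δ]; ring
    · by_cases hij : i = j
      · subst hij
        simp only [if_true]
        exact (hdiag i).2 (h1 i)
      · simp only [if_neg hij, add_zero]
        exact (hoff i j hij).2 (h2 i j hij)

theorem exists_entriesOfResidues_eq {s : ℕ} {J : Finset O} {d : ℤ × (O → ℤ) × (O → ℤ)}
    (h : EntryCond p (s + 3) J d) :
    ∃ y l u w t, (∀ i ∉ J, w i = 0) ∧ entriesOfResidues p s J (((y, l), u, w), t) = d := by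
  obtain ⟨e, a, b⟩ := d
  obtain ⟨⟨⟨e', he⟩, he0, he1⟩, ha, hb, hbJ, ⟨c, c', hc, hc'⟩, -, h⟩ := h
  dsimp only at *
  have hp0 : (p : ℤ) ≠ 0 := Int.natCast_ne_zero.2 hp.out.ne_zero
  have hpos : (0 : ℤ) < p := by exact_mod_cast hp.out.pos
  have hprime : Prime (p : ℤ) := Nat.prime_iff_prime_int.1 hp.out
  choose x hx using fun i => (ha i).1
  have hb' : ∀ i, (p : ℤ) ∣ b i := fun i => by
    by_cases hi : i ∈ J
    · exact (hb i hi).1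
    · simp [hbJ i hi]
  choose z hz using hb'
  have hey : (p : ℤ) ∣ e' := by
    have h1 := mul_left_cancel₀ (pow_ne_zero _ hp0) hc
    refine hprime.dvd_of_dvd_pow (n := 2) ⟨c' + e' * p ^ (s + 1), ?_⟩
    refine mul_left_cancel₀ (pow_ne_zero 2 hp0) ?_
    rw [← h1, he] at hc'
    linear_combination hc'
  obtain ⟨y, rfl⟩ := hey
  have hy0 : 0 ≤ y := by
    have : 0 ≤ (p : ℤ) ^ 2 * y := by rw [he] at he0; linarith
    exact nonneg_of_mul_nonneg_right this (by positivity)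
  have hy1 : y < p := by
    have : (p : ℤ) ^ 2 * y < p ^ 2 * p := by rw [he] at he1; linarith
    exact lt_of_mul_lt_mul_left this (by positivity)
  have hx0 : ∀ i, 0 ≤ x i := fun i => by
    have := (ha i).2.1
    rw [hx i] at this
    exact nonneg_of_mul_nonneg_right this hpos
  have hx1 : ∀ i, x i < p * p := fun i => by
    have := (ha i).2.2
    rw [hx i] at this
    exact lt_of_mul_lt_mul_left (this.trans_eq (by ring)) hpos.le
  have hzz : ∀ i j, i ≠ j → (p : ℤ) ^ (s + 1) ∣ z i * z j := fun i j hij => by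
    obtain ⟨c, -, h1, -⟩ := h i j
    rw [if_neg hij, hz i, hz j] at h1
    exact ⟨c, mul_left_cancel₀ (pow_ne_zero 2 hp0) (by linear_combination h1)⟩
  have hz1 : ∀ i, (p : ℤ) ^ (s + 1) ∣ z i * (z i - 1) := fun i => by
    obtain ⟨c, -, h1, -⟩ := h i i
    rw [if_pos rfl, hz i] at h1
    exact ⟨c, mul_left_cancel₀ (pow_ne_zero 2 hp0) (by linear_combination h1)⟩
  have hzJ : ∀ i ∉ J, z i = 0 := fun i hi => by
    have := hz i
    rw [hbJ i hi] at this
    exact (mul_eq_zero.1 this.symm).resolve_left hp0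
  have hl : ∃ l : Option J, ∀ i, l.unattach = some i ↔ ¬ (p : ℤ) ∣ z i := by
    by_cases hex : ∃ i, ¬ (p : ℤ) ∣ z i
    · obtain ⟨i, hi⟩ := hex
      have hiJ : i ∈ J := by
        by_contra hc
        simp [hzJ i hc] at hi
      refine ⟨some ⟨i, hiJ⟩, fun j => ?_⟩
      simp only [Option.unattach_some, Option.some.injEq]
      refine ⟨fun h => h ▸ hi, fun hj => ?_⟩
      by_contra hij
      rcases hprime.dvd_or_dvd ((dvd_pow_self _ (Nat.succ_ne_zero s)).trans (hzz i j hij)) with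
        h | h
      exacts [hi h, hj h]
    · push Not at hex
      exact ⟨none, fun i => by simp [hex i]⟩
  obtain ⟨l, hl⟩ := hl
  have hw : ∀ i, ∃ w : ℤ, z i = (if l.unattach = some i then 1 else 0) + p ^ (s + 1) * w :=
      fun i => by
    by_cases hi : (p : ℤ) ∣ z i
    · have hcop : IsCoprime ((p : ℤ) ^ (s + 1)) (z i - 1) := by
        obtain ⟨q, hq⟩ := hi
        exact IsCoprime.pow_left ⟨q, -1, by rw [hq]; ring⟩
      obtain ⟨w, hw⟩ := hcop.dvd_of_dvd_mul_right (hz1 i)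
      exact ⟨w, by rw [if_neg (fun h => (hl i).1 h hi), hw]; ring⟩
    · have hcop : IsCoprime ((p : ℤ) ^ (s + 1)) (z i) :=
        IsCoprime.pow_left ((hprime.coprime_iff_not_dvd).2 hi)
      obtain ⟨w, hw⟩ := hcop.dvd_of_dvd_mul_left (hz1 i)
      exact ⟨w, by rw [if_pos ((hl i).2 hi), ← hw]; ring⟩
  choose w hw using hw
  have hpp : (1 : ℤ) < p ^ (s + 1) := one_lt_pow₀ (by exact_mod_cast hp.out.one_lt) (by simp)
  have hwJ : ∀ i ∉ J, w i = 0 := fun i hi => by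
    have h1 := hw i
    rw [if_neg (fun h => (hl i).1 h (by simp [hzJ i hi])), hzJ i hi, zero_add] at h1
    exact (mul_eq_zero.1 h1.symm).resolve_left (by positivity)
  have hz0 : ∀ i ∈ J, 0 ≤ z i := fun i hi => by
    have := (hb i hi).2.1
    rw [hz i] at this
    exact nonneg_of_mul_nonneg_right this hpos
  have hzp : ∀ i ∈ J, z i < p ^ (s + 1) * p := fun i hi => by
    have := (hb i hi).2.2
    rw [hz i] at this
    exact lt_of_mul_lt_mul_left (this.trans_eq (by ring)) hpos.le
  have hwv : ∀ i, (((w i : ZMod p).val : ℕ) : ℤ) = w i := fun i => by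
    by_cases hi : i ∈ J
    · have h0 := hz0 i hi
      have h1 := hzp i hi
      rw [hw i] at h0 h1
      refine val_intCast_of_lt ?_ (lt_of_mul_lt_mul_left (lt_of_le_of_lt ?_ h1)
        (zero_le_one.trans hpp.le))
      · by_contra! hneg
        split_ifs at h0 <;> nlinarith
      · split_ifs <;> linarith
    · simp [hwJ i hi]
  refine ⟨y, l, fun i => x i, fun i => w i, fun i => ((x i / p : ℤ) : ZMod p),
    fun i hi => by simp [hwJ i hi], ?_⟩
  simp only [entriesOfResidues, Prod.mk.injEq]
  refine ⟨?_, funext fun i => ?_, funext fun i => ?_⟩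
  · rw [val_intCast_of_lt hy0 hy1, he]; ring
  · rw [val_intCast_of_lt (Int.ediv_nonneg (hx0 i) hpos.le) (Int.ediv_lt_of_lt_mul hpos (hx1 i)),
      ZMod.val_intCast, Int.emod_add_mul_ediv, hx i]
  · rw [hwv, ← hw, hz]

theorem card_entryCond [Fintype O] (s : ℕ) (J : Finset O) :
    Nat.card {d // EntryCond p (s + 3) J d} =
      Nat.card {d : (ZMod p × Option J) × ((O → ZMod p) × (O → ZMod p)) //
        ResidueCond J d.1.1 d.1.2 d.2.1 d.2.2} * p ^ Fintype.card O := by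
  let f : {d : (ZMod p × Option J) × ((O → ZMod p) × (O → ZMod p)) //
      ResidueCond J d.1.1 d.1.2 d.2.1 d.2.2} × (O → ZMod p) → {d // EntryCond p (s + 3) J d} :=
    fun x => ⟨entriesOfResidues p s J (x.1.1, x.2),
      (entryCond_entriesOfResidues_iff s J _ _ _ _ _ x.1.2.1).2 x.1.2⟩
  have hf : Function.Bijective f := by
    constructor
    · rintro ⟨⟨x, hx⟩, t⟩ ⟨⟨x', hx'⟩, t'⟩ h
      have := entriesOfResidues_injective s J (congrArg Subtype.val h)
      simp only [Prod.mk.injEq] at this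
      exact Prod.ext (Subtype.ext this.1) this.2
    · rintro ⟨d, hd⟩
      obtain ⟨y, l, u, w, t, hw, rfl⟩ := exists_entriesOfResidues_eq hd
      exact ⟨⟨⟨((y, l), u, w), (entryCond_entriesOfResidues_iff s J y l u w t hw).1 hd⟩, t⟩, rfl⟩
  rw [← Nat.card_congr (Equiv.ofBijective f hf), Nat.card_prod]
  simp [Nat.card_eq_fintype_card, ZMod.card]

end Entries

section Matrices

open Matrix

variable {m : ℕ} (p β k : ℕ)

/-- The indices other than those of the first row, the row of `β` and the last row. -/
abbrev OtherIndex (m k : ℕ) : Type := {i : Fin m // (i : ℕ) ≠ 0 ∧ (i : ℕ) ≠ k}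

/-- The matrix with prescribed entries in the first row and the row of `β`. -/
def matrixOfEntries (d : ℤ × (OtherIndex m k → ℤ) × (OtherIndex m k → ℤ)) :
    Matrix (Fin (m + 1)) (Fin (m + 1)) ℤ := fun i j =>
  Fin.lastCases 1 (fun j => Fin.lastCases 0 (fun i =>
    if (i : ℕ) = 0 then
      if h0 : (j : ℕ) = 0 then (p : ℤ) ^ 3 else if hk : (j : ℕ) = k then d.1 else d.2.1 ⟨j, h0, hk⟩
    else if (i : ℕ) = k then
      if h0 : (j : ℕ) = 0 then 0 else if hk : (j : ℕ) = k then (p : ℤ) ^ β else d.2.2 ⟨j, h0, hk⟩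
    else if i = j then p else 0) i) j

variable {p β k}

theorem sum_fin_eq_add_sum_otherIndex {o κ : Fin m} (ho : (o : ℕ) = 0) (hκ : (κ : ℕ) = k)
    (hk : k ≠ 0) (f : Fin m → ℤ) : ∑ i, f i = f o + f κ + ∑ i : OtherIndex m k, f i := by
  have hoκ : κ ≠ o := fun h => hk (by rw [← hκ, h, ho])
  have h : (Finset.univ.erase o).erase κ =
      Finset.univ.filter fun i : Fin m => (i : ℕ) ≠ 0 ∧ (i : ℕ) ≠ k := by
    ext i
    simp [Fin.ext_iff, ho, hκ, and_comm]
  rw [← Finset.add_sum_erase _ _ (Finset.mem_univ o), ← Finset.add_sum_erase _ _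
    (Finset.mem_erase.2 ⟨hoκ, Finset.mem_univ κ⟩), h, ← add_assoc]
  congr 1
  exact (Finset.sum_subtype _ (by simp) f)

theorem fin_cases_otherIndex {o κ : Fin m} (ho : (o : ℕ) = 0) (hκ : (κ : ℕ) = k)
    {C : Fin (m + 1) → Prop} (hlast : C (Fin.last m)) (hCo : C o.castSucc) (hCκ : C κ.castSucc)
    (hC : ∀ i : OtherIndex m k, C i.1.castSucc) (i : Fin (m + 1)) : C i := by
  refine Fin.lastCases hlast (fun i => ?_) i
  by_cases h0 : (i : ℕ) = 0
  · rwa [Fin.ext (h0.trans ho.symm)]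
  by_cases hk : (i : ℕ) = k
  · rwa [Fin.ext (hk.trans hκ.symm)]
  exact hC ⟨i, h0, hk⟩

theorem mulVec_eq_iff {o κ : Fin m} (ho : (o : ℕ) = 0) (hκ : (κ : ℕ) = k) (hk : k ≠ 0)
    (d : ℤ × (OtherIndex m k → ℤ) × (OtherIndex m k → ℤ)) (x v : Fin (m + 1) → ℤ) :
    matrixOfEntries p β k d *ᵥ x = v ↔
      x (Fin.last m) = v (Fin.last m) ∧
      (p : ℤ) ^ 3 * x o.castSucc + d.1 * x κ.castSucc + ∑ i, d.2.1 i * x i.1.castSucc +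
        x (Fin.last m) = v o.castSucc ∧
      (p : ℤ) ^ β * x κ.castSucc + ∑ i, d.2.2 i * x i.1.castSucc +
        x (Fin.last m) = v κ.castSucc ∧
      ∀ i : OtherIndex m k, p * x i.1.castSucc + x (Fin.last m) = v i.1.castSucc := by
  have hi0 : ∀ i : OtherIndex m k, (i.1 : ℕ) ≠ 0 := fun i => i.2.1
  have hik : ∀ i : OtherIndex m k, (i.1 : ℕ) ≠ k := fun i => i.2.2
  have hsum : ∀ i, (matrixOfEntries p β k d *ᵥ x) i =
      matrixOfEntries p β k d i o.castSucc * x o.castSucc +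
      matrixOfEntries p β k d i κ.castSucc * x κ.castSucc +
      ∑ j : OtherIndex m k, matrixOfEntries p β k d i j.1.castSucc * x j.1.castSucc +
      matrixOfEntries p β k d i (Fin.last m) * x (Fin.last m) := fun i => by
    rw [Matrix.mulVec, dotProduct, Fin.sum_univ_castSucc, sum_fin_eq_add_sum_otherIndex ho hκ hk]
  have h1 : (matrixOfEntries p β k d *ᵥ x) (Fin.last m) = x (Fin.last m) := by
    rw [hsum]; simp [matrixOfEntries]
  have h2 : (matrixOfEntries p β k d *ᵥ x) o.castSucc =
      (p : ℤ) ^ 3 * x o.castSucc + d.1 * x κ.castSucc + ∑ i, d.2.1 i * x i.1.castSucc +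
        x (Fin.last m) := by
    rw [hsum]; simp [matrixOfEntries, ho, hκ, hk, hi0, hik]
  have h3 : (matrixOfEntries p β k d *ᵥ x) κ.castSucc =
      (p : ℤ) ^ β * x κ.castSucc + ∑ i, d.2.2 i * x i.1.castSucc + x (Fin.last m) := by
    rw [hsum]; simp [matrixOfEntries, ho, hκ, hk, hi0, hik]
  have h4 : ∀ i : OtherIndex m k, (matrixOfEntries p β k d *ᵥ x) i.1.castSucc =
      p * x i.1.castSucc + x (Fin.last m) := fun i => by
    have hio : i.1 ≠ o := fun h => hi0 i (h ▸ ho)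
    have hiκ : i.1 ≠ κ := fun h => hik i (h ▸ hκ)
    rw [hsum]; simp [matrixOfEntries, hi0, hik, hio, hiκ, Subtype.val_inj]
  rw [← h2, ← h3]
  simp_rw [← h4]
  constructor
  · rintro rfl
    exact ⟨h1.symm, rfl, rfl, fun _ => rfl⟩
  · rintro ⟨e1, e2, e3, e4⟩
    exact funext (fin_cases_otherIndex ho hκ (h1.trans e1) e2 e3 e4)

theorem exists_mulVec_iff (hp : p ≠ 0) {o κ : Fin m} (ho : (o : ℕ) = 0) (hκ : (κ : ℕ) = k)
    (hk : k ≠ 0) (d : ℤ × (OtherIndex m k → ℤ) × (OtherIndex m k → ℤ)) (v : Fin (m + 1) → ℤ)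
    (s : OtherIndex m k → ℤ) (hlast : v (Fin.last m) = 0)
    (hs : ∀ i : OtherIndex m k, v i.1.castSucc = p * s i) :
    (∃ x, matrixOfEntries p β k d *ᵥ x = v) ↔
      ∃ c c' : ℤ, v κ.castSucc = (p : ℤ) ^ β * c + ∑ i, d.2.2 i * s i ∧
        v o.castSucc = (p : ℤ) ^ 3 * c' + d.1 * c + ∑ i, d.2.1 i * s i := by
  have hp0 : (p : ℤ) ≠ 0 := Int.natCast_ne_zero.2 hp
  constructor
  · rintro ⟨x, hx⟩
    obtain ⟨e1, e2, e3, e4⟩ := (mulVec_eq_iff ho hκ hk d x v).1 hx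
    rw [hlast] at e1
    have hxs : ∀ i : OtherIndex m k, x i.1.castSucc = s i := fun i => by
      have := e4 i
      rw [e1, hs, add_zero] at this
      exact mul_left_cancel₀ hp0 this
    simp_rw [hxs, e1, add_zero] at e2 e3
    exact ⟨x κ.castSucc, x o.castSucc, e3.symm, e2.symm⟩
  · rintro ⟨c, c', h1, h2⟩
    let x : Fin (m + 1) → ℤ := fun j => Fin.lastCases 0 (fun j : Fin m =>
      if h0 : (j : ℕ) = 0 then c' else if hk : (j : ℕ) = k then c else s ⟨j, h0, hk⟩) j
    have hx1 : x (Fin.last m) = 0 := by simp [x]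
    have hx2 : x o.castSucc = c' := by simp [x, ho]
    have hx3 : x κ.castSucc = c := by simp [x, hκ, hk]
    have hx4 : ∀ i : OtherIndex m k, x i.1.castSucc = s i := fun i => by
      simp [x, i.2.1, i.2.2]
    refine ⟨x, (mulVec_eq_iff ho hκ hk d x v).2 ?_⟩
    simp only [hx1, hx2, hx3, hx4, hlast, hs, add_zero, true_and, implies_true, and_true]
    exact ⟨h2.symm, h1.symm⟩

theorem products_mem_span_iff (hp : p ≠ 0) {o κ : Fin m} (ho : (o : ℕ) = 0) (hκ : (κ : ℕ) = k)
    (hk : k ≠ 0) (d : ℤ × (OtherIndex m k → ℤ) × (OtherIndex m k → ℤ)) :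
    (∀ i j, ∃ x, matrixOfEntries p β k d *ᵥ x =
      fun r => matrixOfEntries p β k d r i * matrixOfEntries p β k d r j) ↔
    (∃ c c' : ℤ, (p : ℤ) ^ β * (p : ℤ) ^ β = (p : ℤ) ^ β * c ∧
      d.1 * d.1 = (p : ℤ) ^ 3 * c' + d.1 * c) ∧
    (∀ i, ∃ c c' : ℤ, (p : ℤ) ^ β * d.2.2 i = (p : ℤ) ^ β * c ∧
      d.1 * d.2.1 i = (p : ℤ) ^ 3 * c' + d.1 * c) ∧
    ∀ i j, ∃ c c' : ℤ,
      d.2.2 i * d.2.2 j = (p : ℤ) ^ β * c + (if i = j then (p : ℤ) * d.2.2 i else 0) ∧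
      d.2.1 i * d.2.1 j =
        (p : ℤ) ^ 3 * c' + d.1 * c + (if i = j then (p : ℤ) * d.2.1 i else 0) := by
  have hi0 : ∀ i : OtherIndex m k, (i.1 : ℕ) ≠ 0 := fun i => i.2.1
  have hik : ∀ i : OtherIndex m k, (i.1 : ℕ) ≠ k := fun i => i.2.2
  have hio : ∀ i : OtherIndex m k, i.1 ≠ o := fun i h => hi0 i (h ▸ ho)
  have hiκ : ∀ i : OtherIndex m k, i.1 ≠ κ := fun i h => hik i (h ▸ hκ)
  let M := matrixOfEntries p β k d
  have hsymm : ∀ i j, (∃ x, M *ᵥ x = fun r => M r i * M r j) →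
      ∃ x, M *ᵥ x = fun r => M r j * M r i := fun i j h => by
    simpa only [mul_comm] using h
  have hlast : ∀ j, ∃ x, M *ᵥ x = fun r => M r (Fin.last m) * M r j := fun j =>
    ⟨Pi.single j 1, by ext r; simp [M, matrixOfEntries]⟩
  have hfirst : ∀ j, ∃ x, M *ᵥ x = fun r => M r o.castSucc * M r j := fun j => by
    refine (exists_mulVec_iff hp ho hκ hk d _ 0 ?_ fun i => ?_).2 ⟨0, M o.castSucc j, ?_, ?_⟩ <;>
      simp [M, matrixOfEntries, ho, hκ, hk, hi0, hik, hio]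
  have hββ : (∃ x, M *ᵥ x = fun r => M r κ.castSucc * M r κ.castSucc) ↔
      ∃ c c' : ℤ, (p : ℤ) ^ β * (p : ℤ) ^ β = (p : ℤ) ^ β * c ∧
        d.1 * d.1 = (p : ℤ) ^ 3 * c' + d.1 * c := by
    rw [exists_mulVec_iff hp ho hκ hk d _ 0 (by simp [M, matrixOfEntries])
      (fun i => by simp [M, matrixOfEntries, hi0, hik, hiκ])]
    simp [M, matrixOfEntries, ho, hκ, hk]
  have hβi : ∀ i : OtherIndex m k, (∃ x, M *ᵥ x = fun r => M r κ.castSucc * M r i.1.castSucc) ↔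
      ∃ c c' : ℤ, (p : ℤ) ^ β * d.2.2 i = (p : ℤ) ^ β * c ∧
        d.1 * d.2.1 i = (p : ℤ) ^ 3 * c' + d.1 * c := fun i => by
    rw [exists_mulVec_iff hp ho hκ hk d _ 0 (by simp [M, matrixOfEntries])
      (fun i => by simp [M, matrixOfEntries, hi0, hik, hiκ])]
    simp [M, matrixOfEntries, ho, hκ, hk, hi0, hik]
  have hij : ∀ i j : OtherIndex m k,
      (∃ x, M *ᵥ x = fun r => M r i.1.castSucc * M r j.1.castSucc) ↔ ∃ c c' : ℤ,
        d.2.2 i * d.2.2 j = (p : ℤ) ^ β * c + (if i = j then (p : ℤ) * d.2.2 i else 0) ∧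
        d.2.1 i * d.2.1 j =
          (p : ℤ) ^ 3 * c' + d.1 * c + (if i = j then (p : ℤ) * d.2.1 i else 0) := fun i j => by
    rw [exists_mulVec_iff hp ho hκ hk d _ (fun r => if r = i then if i = j then p else 0 else 0)
      (by simp [M, matrixOfEntries]) (fun r => by
        by_cases hri : r = i
        · subst hri
          simp [M, matrixOfEntries, hi0, hik, Subtype.val_inj]
        · simp [M, matrixOfEntries, hi0, hik, Subtype.val_inj, hri])]
    simp [M, matrixOfEntries, ho, hκ, hk, hi0, hik, mul_comm]
  constructor
  · exact fun h => ⟨hββ.1 (h _ _), fun i => (hβi i).1 (h _ _), fun i j => (hij i j).1 (h _ _)⟩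
  · rintro ⟨h1, h2, h3⟩
    refine fin_cases_otherIndex ho hκ hlast hfirst ?_ fun i => ?_
    · exact fin_cases_otherIndex ho hκ (hsymm _ _ (hlast _)) (hsymm _ _ (hfirst _)) (hββ.2 h1)
        fun i => (hβi i).2 (h2 i)
    · exact fin_cases_otherIndex ho hκ (hsymm _ _ (hlast _)) (hsymm _ _ (hfirst _))
        (hsymm _ _ ((hβi i).2 (h2 i))) fun j => (hij i j).2 (h3 i j)

/-- The indices below the row of `β`, excluding the last one. -/
def indicesBelow (m k : ℕ) : Finset (OtherIndex m k) :=
  Finset.univ.filter fun i => k < (i.1 : ℕ)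

theorem isIrrSubringMatrix_matrixOfEntries_iff (hp : p ≠ 0) {o κ : Fin m} (ho : (o : ℕ) = 0)
    (hκ : (κ : ℕ) = k) (hk : k ≠ 0) (d : ℤ × (OtherIndex m k → ℤ) × (OtherIndex m k → ℤ)) :
    IsIrrSubringMatrix p
      (fun i : Fin m => if (i : ℕ) = 0 then 3 else if (i : ℕ) = k then β else 1)
      (matrixOfEntries p β k d) ↔ EntryCond p β (indicesBelow m k) d := by
  have hi0 : ∀ i : OtherIndex m k, (i.1 : ℕ) ≠ 0 := fun i => i.2.1
  have hik : ∀ i : OtherIndex m k, (i.1 : ℕ) ≠ k := fun i => i.2.2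
  have hJ : ∀ i : OtherIndex m k, i ∈ indicesBelow m k ↔ k < (i.1 : ℕ) := fun i => by
    simp [indicesBelow]
  have hrow0 : ∀ i j : Fin m, (i : ℕ) = 0 →
      matrixOfEntries p β k d i.castSucc j.castSucc = if h0 : (j : ℕ) = 0 then (p : ℤ) ^ 3 else
        if hk : (j : ℕ) = k then d.1 else d.2.1 ⟨j, h0, hk⟩ := fun i j h => by
    simp [matrixOfEntries, h]
  have hrowk : ∀ i j : Fin m, (i : ℕ) = k →
      matrixOfEntries p β k d i.castSucc j.castSucc = if h0 : (j : ℕ) = 0 then 0 else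
        if hk : (j : ℕ) = k then (p : ℤ) ^ β else d.2.2 ⟨j, h0, hk⟩ := fun i j h => by
    simp [matrixOfEntries, h, hk]
  have hrow : ∀ i j : Fin m, (i : ℕ) ≠ 0 → (i : ℕ) ≠ k →
      matrixOfEntries p β k d i.castSucc j.castSucc = if i = j then (p : ℤ) else 0 :=
    fun i j h h' => by simp [matrixOfEntries, h, h']
  rw [IsIrrSubringMatrix, products_mem_span_iff hp ho hκ hk]
  constructor
  · rintro ⟨h1, -, -, h4, h5⟩
    refine ⟨?_, fun i => ?_, fun i hi => ?_, fun i hi => ?_, h5⟩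
    · have := h4 o κ (by omega)
      simpa [hrow0 o κ ho, hκ, hk, ho] using this
    · have := h4 o i.1 (by have := hi0 i; omega)
      simpa [hrow0 o i.1 ho, hi0, hik, ho] using this
    · have := h4 κ i.1 (by rw [hκ]; exact (hJ i).1 hi)
      simpa [hrowk κ i.1 hκ, hi0, hik, hκ, hk] using this
    · have := h1 κ.castSucc i.1.castSucc (by
        have := hik i
        rw [hJ] at hi
        simp only [Fin.val_castSucc]
        omega)
      simpa [hrowk κ i.1 hκ, hi0, hik] using this
  · rintro ⟨h1, h2, h3, h4, h5⟩
    refine ⟨fun i j => ?_, fun i => ?_, fun i => by simp [matrixOfEntries], fun i j hij => ?_, h5⟩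
    · refine Fin.lastCases (fun h => absurd h (by simp [Fin.is_le])) (fun j h => ?_) j
      revert h
      refine Fin.lastCases (fun _ => by simp [matrixOfEntries]) (fun i h => ?_) i
      simp only [Fin.val_castSucc] at h
      by_cases i0 : (i : ℕ) = 0
      · omega
      by_cases ik : (i : ℕ) = k
      · rw [hrowk i j ik]
        split_ifs with j0 jk
        · rfl
        · omega
        · exact h4 _ (by rw [hJ]; simp only; omega)
      · rw [hrow i j i0 ik, if_neg (fun e => by rw [e] at h; exact lt_irrefl _ h)]
    · by_cases i0 : (i : ℕ) = 0
      · simp [hrow0 i i i0, i0]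
      by_cases ik : (i : ℕ) = k
      · simp [hrowk i i ik, ik, hk]
      · simp [hrow i i i0 ik, i0, ik]
    · by_cases i0 : (i : ℕ) = 0
      · have j0 : (j : ℕ) ≠ 0 := by omega
        simp only [hrow0 i j i0, i0, j0, if_true, dite_false]
        split_ifs with jk
        · exact h1
        · exact h2 _
      by_cases ik : (i : ℕ) = k
      · have j0 : (j : ℕ) ≠ 0 := by omega
        have jk : (j : ℕ) ≠ k := by omega
        simp only [hrowk i j ik, ik, j0, jk, hk, if_true, if_false, dite_false]
        exact h3 _ (by rw [hJ]; simp only; omega)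
      · rw [hrow i j i0 ik, if_neg (fun e => by rw [e] at hij; exact lt_irrefl _ hij)]
        simp [i0, ik, Nat.pos_of_ne_zero hp]

theorem matrixOfEntries_injective {o κ : Fin m} (ho : (o : ℕ) = 0) (hκ : (κ : ℕ) = k)
    (hk : k ≠ 0) : Function.Injective (matrixOfEntries (m := m) p β k) := by
  rintro ⟨e, a, b⟩ ⟨e', a', b'⟩ h
  refine Prod.ext ?_ (Prod.ext (funext fun i => ?_) (funext fun i => ?_))
  · simpa [matrixOfEntries, ho, hκ, hk] using congrFun (congrFun h o.castSucc) κ.castSucc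
  · simpa [matrixOfEntries, ho, i.2.1, i.2.2] using
      congrFun (congrFun h o.castSucc) i.1.castSucc
  · simpa [matrixOfEntries, hκ, hk, i.2.1, i.2.2] using
      congrFun (congrFun h κ.castSucc) i.1.castSucc

theorem IsIrrSubringMatrix.exists_matrixOfEntries_eq {o κ : Fin m} (ho : (o : ℕ) = 0)
    (hκ : (κ : ℕ) = k) {A : Matrix (Fin (m + 1)) (Fin (m + 1)) ℤ}
    (hA : IsIrrSubringMatrix p
      (fun i : Fin m => if (i : ℕ) = 0 then 3 else if (i : ℕ) = k then β else 1) A) :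
    ∃ d, matrixOfEntries p β k d = A := by
  obtain ⟨h1, h2, h3, h4, -⟩ := hA
  have hdiag : ∀ i j : Fin m, (i : ℕ) = j → A i.castSucc j.castSucc =
      (p : ℤ) ^ (if (i : ℕ) = 0 then 3 else if (i : ℕ) = k then β else 1) := fun i j h => by
    rw [← Fin.ext h, h2]
  refine ⟨(A o.castSucc κ.castSucc, fun i => A o.castSucc i.1.castSucc,
    fun i => A κ.castSucc i.1.castSucc), ?_⟩
  ext i j
  refine Fin.lastCases (by simp [matrixOfEntries, h3]) (fun j => ?_) j
  refine Fin.lastCases (by simp [matrixOfEntries, h1 (Fin.last m) j.castSucc (by simp)])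
    (fun i => ?_) i
  simp only [matrixOfEntries, Fin.lastCases_castSucc]
  split_ifs with i0 j0 jk ik j0 jk hij
  · rw [hdiag i j (by omega), if_pos i0]
  · rw [Fin.ext (i0.trans ho.symm), Fin.ext (jk.trans hκ.symm)]
  · rw [Fin.ext (i0.trans ho.symm)]
  · exact (h1 _ _ (by simp only [Fin.val_castSucc]; omega)).symm
  · rw [hdiag i j (by omega), if_neg i0, if_pos ik]
  · rw [Fin.ext (ik.trans hκ.symm)]
  · rw [hdiag i j (by rw [hij]), if_neg i0, if_neg ik, pow_one]
  · rcases lt_trichotomy (i : ℕ) j with h | h | h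
    · obtain ⟨⟨q, hq⟩, h5, h6⟩ := h4 i j h
      simp only [i0, ik, if_false, pow_one] at h6
      exact (Int.eq_zero_of_dvd_of_nonneg_of_lt h5 h6 ⟨q, hq⟩).symm
    · exact absurd (Fin.ext h) hij
    · exact (h1 _ _ h).symm

theorem gMat_eq_card_entryCond (hp : p ≠ 0) {o κ : Fin m} (ho : (o : ℕ) = 0) (hκ : (κ : ℕ) = k)
    (hk : k ≠ 0) :
    gMat p (fun i : Fin m => if (i : ℕ) = 0 then 3 else if (i : ℕ) = k then β else 1) =
      Nat.card {d // EntryCond p β (indicesBelow m k) d} := by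
  symm
  refine Nat.card_congr (Equiv.ofBijective (fun d => ⟨matrixOfEntries p β k d.1,
    (isIrrSubringMatrix_matrixOfEntries_iff hp ho hκ hk d.1).2 d.2⟩) ⟨fun d d' h => ?_, ?_⟩)
  · exact Subtype.ext (matrixOfEntries_injective ho hκ hk (congrArg Subtype.val h))
  · rintro ⟨A, hA⟩
    obtain ⟨d, rfl⟩ := hA.exists_matrixOfEntries_eq ho hκ
    exact ⟨⟨d, (isIrrSubringMatrix_matrixOfEntries_iff hp ho hκ hk d).1 hA⟩, rfl⟩

theorem card_otherIndex {κ : Fin m} (hκ : (κ : ℕ) = k) (hk : k ≠ 0) :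
    Fintype.card (OtherIndex m k) = m - 2 := by
  have hm : 0 < m := κ.pos
  have h : (Finset.univ.filter fun i : Fin m => (i : ℕ) ≠ 0 ∧ (i : ℕ) ≠ k) =
      (Finset.univ.erase ⟨0, hm⟩).erase κ := by
    ext i
    simp [Fin.ext_iff, hκ, and_comm]
  rw [Fintype.card_subtype, h, Finset.card_erase_of_mem, Finset.card_erase_of_mem
    (Finset.mem_univ _), Finset.card_univ, Fintype.card_fin, Nat.sub_sub]
  simpa [Fin.ext_iff, hκ] using hk

theorem card_indicesBelow {κ : Fin m} (hκ : (κ : ℕ) = k) :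
    (indicesBelow m k).card = m - 1 - k := by
  have h : (indicesBelow m k).map ⟨Subtype.val, Subtype.val_injective⟩ = Finset.Ioi κ := by
    ext i
    simp only [indicesBelow, Finset.mem_map, Finset.mem_filter, Finset.mem_univ, true_and,
      Function.Embedding.coeFn_mk, Finset.mem_Ioi, Fin.lt_def, hκ]
    constructor
    · rintro ⟨j, hj, rfl⟩
      exact hj
    · exact fun hi => ⟨⟨i, by omega, by omega⟩, hi, rfl⟩
  rw [← Finset.card_map, h, Fin.card_Ioi, hκ]

end Matrices

/-- For a prime `p`, `n ≥ 3`, `1 ≤ k ≤ n-2` and `β > 2`, let `α` be the composition of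
length `n-1` with first part `3`, with `β` in the `(k+1)`-th position, and all other
parts `1`.  Then
`g_α(p) = (n-k-1)(n-2)p^{2n-k-5} + ((n-k-1)(k-1) + 1 + (n-k-2)(n-k-3))p^{n-3}(p-1)
  + (n-k-2)p^{n-3}(p-1)² + (n-k-2)p^{n-2}(p-1) + (n-k-2)(n-k-3)p^{n-3}(p-1)(p-2)`. -/
theorem gMat_three_beta (p : ℕ) (hp : p.Prime) (n k β : ℕ) (hn : 3 ≤ n)
    (hk1 : 1 ≤ k) (hkn : k ≤ n - 2) (hβ : 2 < β) :
    (gMat p (fun i : Fin (n - 1) =>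
        if (i : ℕ) = 0 then 3 else if (i : ℕ) = k then β else 1) : ℤ) =
      ((n : ℤ) - k - 1) * ((n : ℤ) - 2) * (p : ℤ) ^ (2 * n - k - 5)
        + (((n : ℤ) - k - 1) * ((k : ℤ) - 1) + 1 + ((n : ℤ) - k - 2) * ((n : ℤ) - k - 3))
            * (p : ℤ) ^ (n - 3) * ((p : ℤ) - 1)
        + ((n : ℤ) - k - 2) * (p : ℤ) ^ (n - 3) * ((p : ℤ) - 1) ^ 2
        + ((n : ℤ) - k - 2) * (p : ℤ) ^ (n - 2) * ((p : ℤ) - 1)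
        + ((n : ℤ) - k - 2) * ((n : ℤ) - k - 3) * (p : ℤ) ^ (n - 3) * ((p : ℤ) - 1)
            * ((p : ℤ) - 2) := by
  obtain ⟨m, rfl⟩ : ∃ m, n = m + 1 := ⟨n - 1, by omega⟩
  obtain ⟨s, rfl⟩ : ∃ s, β = s + 3 := ⟨β - 3, by omega⟩
  have hkm : k < m := by omega
  have hk : k ≠ 0 := by omega
  have : Fact p.Prime := ⟨hp⟩
  have h := gMat_eq_card_entryCond (p := p) (β := s + 3) (o := (⟨0, by omega⟩ : Fin m))
    (κ := ⟨k, hkm⟩) hp.ne_zero rfl rfl hk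
  rw [card_entryCond] at h
  refine (congrArg (Nat.cast : ℕ → ℤ) h).trans ?_
  rw [Nat.cast_mul, card_residueCond, card_indicesBelow (κ := ⟨k, hkm⟩) rfl,
    card_otherIndex (κ := ⟨k, hkm⟩) rfl hk, ZMod.card]
  obtain ⟨r, rfl⟩ : ∃ r, m = k + 1 + r := ⟨m - 1 - k, by omega⟩
  obtain ⟨j, rfl⟩ : ∃ j, k = j + 1 := ⟨k - 1, by omega⟩
  have e1 : j + 1 + 1 + r - 2 = j + r := by omega
  have e2 : j + 1 + 1 + r - 1 - (j + 1) = r := by omega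
  have e3 : 2 * (j + 1 + 1 + r + 1) - (j + 1) - 5 = j + r + r := by omega
  have e4 : j + 1 + 1 + r + 1 - 3 = j + r := by omega
  have e5 : j + 1 + 1 + r + 1 - 2 = j + r + 1 := by omega
  rw [e1, e2, e3, e4, e5]
  push_cast
  ring
end
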